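/- There exists a constant c > 0 such that for every prime p > 2, every quadratic polynomial f(x,y) ∈ F_p[x,y] that depends on both variables and is not of the form g(αx + βy) for any univariate polynomial g ∈ F_p[x] and any α, β ∈ F_p, and every set A ⊆ F_p with |A| ≤ p^(5/8), we have max{|A + A|, |f(A,A)|} ≥ c·|A|^(6/5). -/

import Mathlib

open Finset Pointwise



namespace Rud

section basics

variable {K : Type*} [Field K]

/-- A line: flag, eta, u, w. -/
abbrev Ln (K : Type*) := Bool × K × K × K

/-- Restriction of a polynomial to a line. -/
noncomputable def phi (a : Ln K) : MvPolynomial (Fin 3) K →ₐ[K] Polynomial K :=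
  MvPolynomial.aeval ![Polynomial.C a.2.2.2 - Polynomial.C a.2.2.1 * Polynomial.X,
    if a.1 then Polynomial.C a.2.1 else Polynomial.X,
    if a.1 then Polynomial.X else Polynomial.C a.2.1]

lemma phi_X0 (a : Ln K) : phi a (MvPolynomial.X 0) =
    Polynomial.C a.2.2.2 - Polynomial.C a.2.2.1 * Polynomial.X := by simp [phi]
lemma phi_X1 (a : Ln K) : phi a (MvPolynomial.X 1) =
    if a.1 then Polynomial.C a.2.1 else Polynomial.X := by simp [phi]
lemma phi_X2 (a : Ln K) : phi a (MvPolynomial.X 2) =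
    if a.1 then Polynomial.X else Polynomial.C a.2.1 := by simp [phi]
lemma phi_C (a : Ln K) (c : K) : phi a (MvPolynomial.C c) = Polynomial.C c := by simp [phi]

def Adj (a b : Ln K) : Prop :=
  a.1 ≠ b.1 ∧ a.2.2.2 - a.2.2.1 * b.2.1 = b.2.2.2 - b.2.2.1 * a.2.1

lemma Adj.symm {a b : Ln K} (h : Adj a b) : Adj b a := ⟨h.1.symm, h.2.symm⟩

lemma eval_adj {a b : Ln K} (h : Adj a b) (P : MvPolynomial (Fin 3) K) :
    (phi a P).eval b.2.1 = (phi b P).eval a.2.1 := by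
  have : (Polynomial.aeval b.2.1).comp (phi a) = (Polynomial.aeval a.2.1).comp (phi b) := by
    apply MvPolynomial.algHom_ext
    obtain ⟨f, e, u, w⟩ := a
    obtain ⟨f', e', u', w'⟩ := b
    obtain ⟨h1, h2⟩ := h
    simp only at h1 h2
    intro i
    fin_cases i
    · simpa [phi] using h2
    · cases f <;> cases f' <;> simp_all [phi]
    · cases f <;> cases f' <;> simp_all [phi]
  have := DFunLike.congr_fun this P
  simpa [Polynomial.aeval_def, Polynomial.eval₂_eq_eval_map] using this

lemma natDegree_phi (a : Ln K) (P : MvPolynomial (Fin 3) K) :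
    (phi a P).natDegree ≤ P.totalDegree := by
  have := MvPolynomial.aeval_natDegree_le P (m := P.totalDegree) le_rfl
    ![Polynomial.C a.2.2.2 - Polynomial.C a.2.2.1 * Polynomial.X,
    if a.1 then Polynomial.C a.2.1 else Polynomial.X,
    if a.1 then Polynomial.X else Polynomial.C a.2.1] (n := 1) (by
      intro i
      fin_cases i
      · simp only [Fin.zero_eta, Matrix.cons_val_zero]
        compute_degree
      · simp only [Fin.mk_one, Matrix.cons_val_one]
        split_ifs <;> simp
      · simp only [Fin.reduceFinMk, Matrix.cons_val]
        split_ifs <;> simp)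
  simpa [phi] using this

/-- Family condition: equal flag and eta imply equal u. -/
def Good (T : Finset (Ln K)) : Prop :=
  ∀ a ∈ T, ∀ b ∈ T, a.1 = b.1 → a.2.1 = b.2.1 → a.2.2.1 = b.2.2.1

lemma Good.mono {T T' : Finset (Ln K)} (h : Good T) (hs : T' ⊆ T) : Good T' :=
  fun a ha b hb => h a (hs ha) b (hs hb)

open Classical in
lemma card_nb_le {T : Finset (Ln K)} (hT : Good T) (a : Ln K) (P : MvPolynomial (Fin 3) K)
    (hP : phi a P ≠ 0) :
    #{b ∈ T | Adj a b ∧ phi b P = 0} ≤ P.totalDegree := by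
  refine le_trans ?_ (natDegree_phi a P)
  refine le_trans ?_ (Polynomial.card_roots' _)
  refine le_trans ?_ (Multiset.toFinset_card_le _)
  apply Finset.card_le_card_of_injOn (fun b => b.2.1)
  · intro b hb
    simp only [Finset.coe_filter, Set.mem_ofPred_eq] at hb
    simp only [Finset.mem_coe, Multiset.mem_toFinset, Polynomial.mem_roots hP, Polynomial.IsRoot]
    rw [eval_adj hb.2.1, hb.2.2]; simp
  · rintro ⟨f, e, u, w⟩ hb ⟨f', e', u', w'⟩ hb' h
    simp only [Finset.coe_filter, Set.mem_ofPred_eq] at hb hb'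
    simp only at h
    subst h
    have hf : f = f' := by
      have h1 := hb.2.1.1
      have h2 := hb'.2.1.1
      simp only at h1 h2
      cases f <;> cases f' <;> simp_all
    subst hf
    have hu := hT _ hb.1 _ hb'.1 rfl rfl
    simp only at hu
    subst hu
    have h1 := hb.2.1.2
    have h2 := hb'.2.1.2
    simp only at h1 h2
    rw [h1] at h2
    simp only [sub_left_inj] at h2
    subst h2
    rfl

open Classical in
/-- Number of incident pairs between two families. -/
noncomputable def cr (T U : Finset (Ln K)) : ℕ := ∑ a ∈ T, #{b ∈ U | Adj a b}

open Classical in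
lemma cr_comm (T U : Finset (Ln K)) : cr T U = cr U T := by
  unfold cr
  have := Finset.sum_card_bipartiteAbove_eq_sum_card_bipartiteBelow (s := T) (t := U)
    (fun a b : Ln K => Adj a b)
  simp only [Finset.bipartiteAbove, Finset.bipartiteBelow] at this
  rw [this]
  refine Finset.sum_congr rfl fun b _ => ?_
  congr 1
  ext a
  simp only [Finset.mem_filter]
  exact and_congr_right fun _ => ⟨Adj.symm, Adj.symm⟩

lemma cr_union_left {T1 T2 U : Finset (Ln K)} [DecidableEq (Ln K)] (h : Disjoint T1 T2) :
    cr (T1 ∪ T2) U = cr T1 U + cr T2 U := by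
  unfold cr
  rw [Finset.sum_union h]

lemma cr_union_right {T1 T2 U : Finset (Ln K)} [DecidableEq (Ln K)] (h : Disjoint T1 T2) :
    cr U (T1 ∪ T2) = cr U T1 + cr U T2 := by
  rw [cr_comm, cr_union_left h, cr_comm, cr_comm T2]

lemma cr_self_union {T1 T2 : Finset (Ln K)} [DecidableEq (Ln K)] (h : Disjoint T1 T2) :
    cr (T1 ∪ T2) (T1 ∪ T2) = cr T1 T1 + cr T2 T2 + 2 * cr T2 T1 := by
  rw [cr_union_left h, cr_union_right h, cr_union_right h, cr_comm T1 T2]; ring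

open Classical in
lemma cr_le_mul {T U : Finset (Ln K)} {d : ℕ} (h : ∀ a ∈ T, #{b ∈ U | Adj a b} ≤ d) :
    cr T U ≤ #T * d := by
  unfold cr
  simpa using Finset.sum_le_card_nsmul T _ d h

open Classical in
/-- Splitting along a polynomial. -/
lemma cr_split {T : Finset (Ln K)} (hT : Good T) (P : MvPolynomial (Fin 3) K) :
    cr T T ≤ cr {a ∈ T | phi a P = 0} {a ∈ T | phi a P = 0}
      + cr {a ∈ T | ¬ phi a P = 0} {a ∈ T | ¬ phi a P = 0}
      + 2 * (#{a ∈ T | ¬ phi a P = 0} * P.totalDegree) := by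
  have hd : Disjoint {a ∈ T | phi a P = 0} {a ∈ T | ¬ phi a P = 0} :=
    Finset.disjoint_filter_filter_not _ _ _
  have h := cr_self_union hd
  rw [Finset.filter_union_filter_not_eq] at h
  rw [h]
  gcongr
  apply cr_le_mul
  intro a ha
  rw [Finset.mem_filter] at ha
  refine le_trans (Finset.card_le_card ?_) (card_nb_le hT a P ha.2)
  intro b hb
  simp only [Finset.mem_filter] at hb ⊢
  tauto

end basics

end Rud


namespace Rud

section bezout

variable {K : Type*} [Field K]

/-- Polynomials with bounded partial degrees. -/
noncomputable def Box (K : Type*) [Field K] (m : Fin 3 → ℕ) : Submodule K (MvPolynomial (Fin 3) K) :=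
  MvPolynomial.restrictSupport K {n | ∀ i, n i ≤ m i}

lemma mem_Box {m : Fin 3 → ℕ} {P : MvPolynomial (Fin 3) K} :
    P ∈ Box K m ↔ ∀ i, P.degreeOf i ≤ m i := by
  unfold Box
  rw [MvPolynomial.mem_restrictSupport_iff]
  constructor
  · intro h i
    rw [MvPolynomial.degreeOf_le_iff]
    intro s hs
    exact h hs i
  · intro h s hs i
    exact MvPolynomial.degreeOf_le_iff.mp (h i) s hs

noncomputable def boxEquiv (m : Fin 3 → ℕ) :
    ({n | ∀ i, n i ≤ m i} : Set (Fin 3 →₀ ℕ)) ≃ ∀ i, Fin (m i + 1) where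
  toFun n i := ⟨n.1 i, Nat.lt_succ_of_le (n.2 i)⟩
  invFun f := ⟨Finsupp.equivFunOnFinite.symm fun i => (f i).1, fun i => by
    simpa using Nat.le_of_lt_succ (f i).2⟩
  left_inv n := by
    apply Subtype.ext
    ext i
    simp
  right_inv f := by
    ext i
    simp

noncomputable instance (m : Fin 3 → ℕ) : Module.Finite K (Box K m) := by
  have : Finite ({n | ∀ i, n i ≤ m i} : Set (Fin 3 →₀ ℕ)) := Finite.of_equiv _ (boxEquiv m).symm
  exact Module.Finite.of_basis (MvPolynomial.basisRestrictSupport K _)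

lemma finrank_Box (m : Fin 3 → ℕ) :
    Module.finrank K (Box K m) = (m 0 + 1) * (m 1 + 1) * (m 2 + 1) := by
  unfold Box
  rw [Module.finrank_eq_nat_card_basis (MvPolynomial.basisRestrictSupport K _),
    Nat.card_congr (boxEquiv m)]
  simp [Fin.prod_univ_three]

lemma exists_sep {T : Finset (Ln K)} (hT : Good T) {a c : Ln K} (ha : a ∈ T) (hc : c ∈ T)
    (hac : a ≠ c) : ∃ q : MvPolynomial (Fin 3) K, phi c q = 0 ∧ phi a q ≠ 0 ∧ q.totalDegree ≤ 1 := by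
  have hXsub : ∀ e : K, (Polynomial.X - Polynomial.C e : Polynomial K) ≠ 0 :=
    Polynomial.X_sub_C_ne_zero
  have hdeg : ∀ (i : Fin 3) (e : K),
      (MvPolynomial.X i - MvPolynomial.C e : MvPolynomial (Fin 3) K).totalDegree ≤ 1 := by
    intro i e
    refine (MvPolynomial.totalDegree_sub _ _).trans ?_
    simp
  by_cases h : a.1 = c.1 ∧ a.2.1 = c.2.1
  · have hu := hT a ha c hc h.1 h.2
    have hw : a.2.2.2 ≠ c.2.2.2 := by
      intro hw
      apply hac
      obtain ⟨f, e, u, w⟩ := a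
      obtain ⟨f', e', u', w'⟩ := c
      simp_all
    refine ⟨MvPolynomial.X 0 + MvPolynomial.C c.2.2.1 *
      MvPolynomial.X (if c.1 then 2 else 1) - MvPolynomial.C c.2.2.2, ?_, ?_, ?_⟩
    · rw [map_sub, map_add, map_mul, phi_X0, phi_C, phi_C]
      cases hf : c.1 <;> simp [phi_X1, phi_X2, hf]
    · rw [map_sub, map_add, map_mul, phi_X0, phi_C, phi_C, ← hu]
      have : phi a (MvPolynomial.X (if c.1 then 2 else 1)) = Polynomial.X := by
        cases hf : c.1 <;> simp [phi_X1, phi_X2, hf, h.1]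
      rw [this]
      intro h0
      apply hw
      have : Polynomial.C (a.2.2.2 - c.2.2.2) = 0 := by
        rw [Polynomial.C_sub]; linear_combination h0
      rw [Polynomial.C_eq_zero] at this
      exact sub_eq_zero.mp this
    · refine (MvPolynomial.totalDegree_sub _ _).trans ?_
      simp only [MvPolynomial.totalDegree_C, max_le_iff, zero_le, and_true]
      refine (MvPolynomial.totalDegree_add _ _).trans ?_
      simp only [MvPolynomial.totalDegree_X, max_le_iff, le_refl, true_and]
      refine (MvPolynomial.totalDegree_mul _ _).trans ?_
      simp
  · refine ⟨MvPolynomial.X (if c.1 then 1 else 2) - MvPolynomial.C c.2.1, ?_, ?_, hdeg _ _⟩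
    · rw [map_sub, phi_C]
      cases hf : c.1 <;> simp [phi_X1, phi_X2, hf]
    · rw [map_sub, phi_C]
      cases hf : c.1 <;> cases hf' : a.1 <;>
        simp only [phi_X1, phi_X2, hf', if_true, if_false, Bool.false_eq_true]
      · rw [← Polynomial.C_sub]
        simp only [ne_eq, Polynomial.C_eq_zero, sub_eq_zero]
        intro h'; exact h ⟨by rw [hf, hf'], h'⟩
      · exact hXsub _
      · exact hXsub _
      · rw [← Polynomial.C_sub]
        simp only [ne_eq, Polynomial.C_eq_zero, sub_eq_zero]
        intro h'; exact h ⟨by rw [hf, hf'], h'⟩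

lemma exists_sep_all {T : Finset (Ln K)} (hT : Good T) {a : Ln K} (ha : a ∈ T) :
    ∃ q : MvPolynomial (Fin 3) K, (∀ c ∈ T, c ≠ a → phi c q = 0) ∧ phi a q ≠ 0 ∧
      q.totalDegree ≤ #T := by
  classical
  have : ∀ c : Ln K, ∃ q : MvPolynomial (Fin 3) K, c ∈ T → a ≠ c →
      (phi c q = 0 ∧ phi a q ≠ 0 ∧ q.totalDegree ≤ 1) := by
    intro c
    by_cases h : c ∈ T ∧ a ≠ c
    · obtain ⟨q, hq⟩ := exists_sep hT ha h.1 h.2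
      exact ⟨q, fun _ _ => hq⟩
    · exact ⟨0, fun h1 h2 => absurd ⟨h1, h2⟩ h⟩
  choose q hq using this
  refine ⟨∏ c ∈ T.erase a, q c, ?_, ?_, ?_⟩
  · intro c hc hca
    rw [map_prod]
    exact Finset.prod_eq_zero (Finset.mem_erase.mpr ⟨hca, hc⟩) (hq c hc hca.symm).1
  · rw [map_prod, Finset.prod_ne_zero_iff]
    intro c hc
    rw [Finset.mem_erase] at hc
    exact (hq c hc.2 hc.1.symm).2.1
  · refine (MvPolynomial.totalDegree_finsetProd _ _).trans ?_
    refine (Finset.sum_le_card_nsmul _ _ 1 ?_).trans ?_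
    · intro c hc
      rw [Finset.mem_erase] at hc
      exact (hq c hc.2 hc.1.symm).2.2
    · simp only [smul_eq_mul, mul_one]
      exact Finset.card_le_card (Finset.erase_subset _ _)

lemma totalDegree_aeval_le (Y : MvPolynomial (Fin 3) K) (hY : Y.totalDegree ≤ 1)
    (c : Polynomial K) : (Polynomial.aeval Y c).totalDegree ≤ c.natDegree := by
  rw [Polynomial.aeval_eq_sum_range]
  refine MvPolynomial.totalDegree_finsetSum_le fun i hi => ?_
  refine (MvPolynomial.totalDegree_smul_le _ _).trans ?_
  refine (MvPolynomial.totalDegree_pow _ _).trans ?_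
  have : i ≤ c.natDegree := by simpa [Nat.lt_succ_iff] using hi
  nlinarith

lemma finrank_map_inj {V W : Type*} [AddCommGroup V] [Module K V] [AddCommGroup W] [Module K W]
    {f : V →ₗ[K] W} (hf : Function.Injective f) (p : Submodule K V) :
    Module.finrank K (p.map f) = Module.finrank K p :=
  (Submodule.equivMapOfInjective f hf p).finrank_eq.symm

lemma bezout_arith {b D E m d0 d1 d2 e0 e1 e2 : ℕ} (hm : m = 2 * b + D + E)
    (z0 : d0 ≤ D) (z1 : d1 ≤ D) (z2 : d2 ≤ D) (y0 : e0 ≤ E) (y1 : e1 ≤ E) (y2 : e2 ≤ E)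
    (key : b * (m - b + 1) + (m - d0 + 1) * (m - d1 + 1) * (m - d2 + 1) +
      (m - e0 + 1) * (m - e1 + 1) * (m - e2 + 1) ≤ (m + 1) * (m + 1) * (m + 1) +
      (m - d0 - e0 + 1) * (m - d1 - e1 + 1) * (m - d2 - e2 + 1)) :
    b ≤ 12 * (D * E) := by
  have key2 : (b : ℤ) * (m - b + 1) + (m - d0 + 1) * (m - d1 + 1) * (m - d2 + 1) +
      (m - e0 + 1) * (m - e1 + 1) * (m - e2 + 1) ≤ (m + 1) * (m + 1) * (m + 1) +
      (m - d0 - e0 + 1) * (m - d1 - e1 + 1) * (m - d2 - e2 + 1) := by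
    zify [show b ≤ m by omega, show d0 ≤ m by omega, show d1 ≤ m by omega,
      show d2 ≤ m by omega, show e0 ≤ m by omega, show e1 ≤ m by omega,
      show e2 ≤ m by omega, show e0 ≤ m - d0 by omega,
      show e1 ≤ m - d1 by omega, show e2 ≤ m - d2 by omega] at key
    exact key
  have hmz : (m : ℤ) = 2 * b + D + E := by rw [hm]; push_cast; ring
  have hcross : ∀ x y : ℕ, x ≤ D → y ≤ E → (x : ℤ) * y ≤ D * E := by
    intro x y hx hy; exact_mod_cast Nat.mul_le_mul hx hy
  have hσ : ((d0 : ℤ) * e1 + d0 * e2 + d1 * e0 + d1 * e2 + d2 * e0 + d2 * e1) ≤ 6 * (D * E) := by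
    linarith [hcross d0 e1 z0 y1, hcross d0 e2 z0 y2, hcross d1 e0 z1 y0, hcross d1 e2 z1 y2,
      hcross d2 e0 z2 y0, hcross d2 e1 z2 y1]
  have hcube : (0 : ℤ) ≤ (d0 + e0) * (d1 + e1) * (d2 + e2) - d0 * d1 * d2 - e0 * e1 * e2 := by
    have : (d0 + e0 : ℤ) * (d1 + e1) * (d2 + e2) - d0 * d1 * d2 - e0 * e1 * e2 =
      d0 * d1 * e2 + d0 * e1 * d2 + d0 * e1 * e2 + e0 * d1 * d2 + e0 * d1 * e2 + e0 * e1 * d2 := by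
      ring
    rw [this]; positivity
  have hid : (m + 1 : ℤ) * (m + 1) * (m + 1) +
      (m - d0 - e0 + 1) * (m - d1 - e1 + 1) * (m - d2 - e2 + 1)
      - (m - d0 + 1) * (m - d1 + 1) * (m - d2 + 1) - (m - e0 + 1) * (m - e1 + 1) * (m - e2 + 1)
      = (m + 1) * (d0 * e1 + d0 * e2 + d1 * e0 + d1 * e2 + d2 * e0 + d2 * e1)
      - ((d0 + e0) * (d1 + e1) * (d2 + e2) - d0 * d1 * d2 - e0 * e1 * e2) := by ring
  have h5 : (b : ℤ) * (m - b + 1) ≤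
      (m + 1) * (d0 * e1 + d0 * e2 + d1 * e0 + d1 * e2 + d2 * e0 + d2 * e1) := by
    generalize (m + 1 : ℤ) * (d0 * e1 + d0 * e2 + d1 * e0 + d1 * e2 + d2 * e0 + d2 * e1) = x1 at *
    generalize (d0 + e0 : ℤ) * (d1 + e1) * (d2 + e2) - d0 * d1 * d2 - e0 * e1 * e2 = x2 at *
    generalize (m + 1 : ℤ) * (m + 1) * (m + 1) = x3 at *
    generalize (m - d0 - e0 + 1 : ℤ) * (m - d1 - e1 + 1) * (m - d2 - e2 + 1) = x4 at *
    generalize (m - d0 + 1 : ℤ) * (m - d1 + 1) * (m - d2 + 1) = x5 at *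
    generalize (m - e0 + 1 : ℤ) * (m - e1 + 1) * (m - e2 + 1) = x6 at *
    generalize (b : ℤ) * (m - b + 1) = x7 at *
    omega
  have hmain : (b : ℤ) * (m - b + 1) ≤ (m + 1) * (6 * (D * E)) :=
    h5.trans (mul_le_mul_of_nonneg_left hσ (by positivity))
  have hfin : (b : ℤ) * (b + D + E + 1) ≤ (12 * (D * E)) * (b + D + E + 1) := by
    have h6 : (b : ℤ) * (m - b + 1) = b * (b + D + E + 1) := by rw [hmz]; ring
    rw [h6, hmz] at hmain
    refine hmain.trans ?_
    have h0 : (0 : ℤ) ≤ D * E := by positivity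
    have h7 : (0 : ℤ) ≤ (D * E) * (D + E + 1) := by positivity
    linarith
  have := le_of_mul_le_mul_right hfin (by positivity)
  exact_mod_cast this

set_option maxHeartbeats 2000000 in
lemma bezout {T : Finset (Ln K)} (hT : Good T) {F G : MvPolynomial (Fin 3) K} (hF : Prime F)
    (hFG : ¬ F ∣ G) (h1 : ∀ a ∈ T, phi a F = 0) (h2 : ∀ a ∈ T, phi a G = 0) :
    #T ≤ 12 * (F.totalDegree * G.totalDegree) := by
  classical
  have hF0 : F ≠ 0 := hF.ne_zero
  have hG0 : G ≠ 0 := by rintro rfl; simp at hFG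
  set D := F.totalDegree with hD
  set E := G.totalDegree with hE
  set b := #T with hb
  set m : ℕ := 2 * b + D + E with hm
  set d : Fin 3 → ℕ := fun i => F.degreeOf i with hd
  set e : Fin 3 → ℕ := fun i => G.degreeOf i with he
  have hdD : ∀ i, d i ≤ D := fun i => MvPolynomial.degreeOf_le_totalDegree F i
  have heE : ∀ i, e i ≤ E := fun i => MvPolynomial.degreeOf_le_totalDegree G i
  -- subspaces
  set V := Box K (fun _ => m) with hV
  set W1 := (Box K (fun i => m - d i)).map (LinearMap.mulLeft K F) with hW1
  set W2 := (Box K (fun i => m - e i)).map (LinearMap.mulLeft K G) with hW2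
  have injF : Function.Injective (LinearMap.mulLeft K F) := fun x y h => by
    simpa [hF0] using h
  have injG : Function.Injective (LinearMap.mulLeft K G) := fun x y h => by
    simpa [hG0] using h
  have injFG : Function.Injective (LinearMap.mulLeft K (F * G)) := fun x y h => by
    simpa [hF0, hG0] using h
  have r1 : Module.finrank K W1 = (m - d 0 + 1) * (m - d 1 + 1) * (m - d 2 + 1) := by
    rw [hW1, finrank_map_inj injF, finrank_Box]
  have r2 : Module.finrank K W2 = (m - e 0 + 1) * (m - e 1 + 1) * (m - e 2 + 1) := by
    rw [hW2, finrank_map_inj injG, finrank_Box]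
  have r12 : Module.finrank K (W1 ⊓ W2 : Submodule K (MvPolynomial (Fin 3) K)) ≤
      (m - d 0 - e 0 + 1) * (m - d 1 - e 1 + 1) * (m - d 2 - e 2 + 1) := by
    have hle : W1 ⊓ W2 ≤ (Box K (fun i => m - d i - e i)).map (LinearMap.mulLeft K (F * G)) := by
      rintro x ⟨⟨p, hp, hpx⟩, ⟨q, hq, hqx⟩⟩
      simp only [LinearMap.mulLeft_apply] at hpx hqx
      have hdv : F ∣ G * q := ⟨p, by rw [hqx, hpx]⟩
      obtain ⟨r, hr⟩ := (hF.dvd_or_dvd hdv).resolve_left hFG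
      refine ⟨r, ?_, ?_⟩
      · have hpr : p = G * r := by
          apply mul_left_cancel₀ hF0
          rw [hpx, ← hqx, hr]; ring
        rw [SetLike.mem_coe, mem_Box] at hp ⊢
        intro i
        by_cases hr0 : r = 0
        · simp [hr0]
        · have := hp i
          rw [hpr, MvPolynomial.degreeOf_mul_eq hG0 hr0] at this
          simp only [he]
          omega
      · simp only [LinearMap.mulLeft_apply]
        rw [← hqx, hr]; ring
    refine (Submodule.finrank_mono hle).trans ?_
    rw [finrank_map_inj injFG, finrank_Box]
  have rV : Module.finrank K V = (m + 1) * (m + 1) * (m + 1) := by rw [hV, finrank_Box]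
  have hW1V : W1 ≤ V := by
    rintro x ⟨p, hp, rfl⟩
    rw [SetLike.mem_coe, mem_Box] at hp
    rw [hV, mem_Box]
    intro i
    rw [LinearMap.mulLeft_apply]
    refine (MvPolynomial.degreeOf_mul_le _ _ _).trans ?_
    have := hp i
    have := hdD i
    simp only [hd] at *
    omega
  have hW2V : W2 ≤ V := by
    rintro x ⟨p, hp, rfl⟩
    rw [SetLike.mem_coe, mem_Box] at hp
    rw [hV, mem_Box]
    intro i
    rw [LinearMap.mulLeft_apply]
    refine (MvPolynomial.degreeOf_mul_le _ _ _).trans ?_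
    have := hp i
    have := heE i
    simp only [he] at *
    omega
  -- independent functions
  have hsep : ∀ a : T, ∃ q : MvPolynomial (Fin 3) K, (∀ c ∈ T, c ≠ a.1 → phi c q = 0) ∧
      phi a.1 q ≠ 0 ∧ q.totalDegree ≤ #T := fun a => exists_sep_all hT a.2
  choose q hq using hsep
  set Y : MvPolynomial (Fin 3) K := MvPolynomial.X 1 + MvPolynomial.X 2 with hY
  have hYdeg : Y.totalDegree ≤ 1 := by
    refine (MvPolynomial.totalDegree_add _ _).trans ?_
    simp
  have hphiY : ∀ a : Ln K, phi a Y = Polynomial.X + Polynomial.C a.2.1 := by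
    intro a
    rw [hY, map_add, phi_X1, phi_X2]
    cases a.1 <;> simp [add_comm]
  let θ : (T → Polynomial.degreeLT K (m - b + 1)) →ₗ[K] MvPolynomial (Fin 3) K :=
    ∑ a : T, (LinearMap.mulLeft K (q a)) ∘ₗ (Polynomial.aeval Y).toLinearMap ∘ₗ
      (Submodule.subtype _) ∘ₗ (LinearMap.proj a)
  have hθ : ∀ c, θ c = ∑ a : T, q a * Polynomial.aeval Y (c a : Polynomial K) := by
    intro c; simp [θ]
  have hphiθ : ∀ c (a : T), phi a.1 (θ c) =
      phi a.1 (q a) * (c a : Polynomial K).comp (Polynomial.X + Polynomial.C a.1.2.1) := by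
    intro c a
    rw [hθ, map_sum, Finset.sum_eq_single a]
    · rw [map_mul, ← Polynomial.aeval_algHom_apply, hphiY, Polynomial.comp, Polynomial.aeval_def]
      rfl
    · intro a' _ ha'
      rw [map_mul, (hq a').1 a.1 a.2 (fun h => ha' (Subtype.ext h.symm)), zero_mul]
    · simp
  have hker : ∀ c, (∀ a : T, phi a.1 (θ c) = 0) → c = 0 := by
    intro c hc
    funext a
    have := hc a
    rw [hphiθ] at this
    have h3 := (mul_eq_zero.mp this).resolve_left (hq a).2.1
    apply Subtype.ext
    simp only [Pi.zero_apply, ZeroMemClass.coe_zero]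
    have h4 : ((c a : Polynomial K).comp (Polynomial.X + Polynomial.C a.1.2.1)).comp
      (Polynomial.X - Polynomial.C a.1.2.1) = 0 := by rw [h3]; simp
    rw [Polynomial.comp_assoc] at h4
    simpa using h4
  have θinj : Function.Injective θ := by
    rw [← LinearMap.ker_eq_bot, LinearMap.ker_eq_bot']
    intro c hc
    apply hker
    intro a
    rw [hc, map_zero]
  have rU : Module.finrank K (LinearMap.range θ) = b * (m - b + 1) := by
    rw [LinearMap.finrank_range_of_inj θinj, Module.finrank_pi_fintype]
    have : Module.finrank K (Polynomial.degreeLT K (m - b + 1)) = m - b + 1 := by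
      rw [(Polynomial.degreeLTEquiv K (m - b + 1)).finrank_eq]; simp
    simp [this, hb]
  have hUV : LinearMap.range θ ≤ V := by
    rintro x ⟨c, rfl⟩
    rw [hV, mem_Box]
    intro i
    refine (MvPolynomial.degreeOf_le_totalDegree _ i).trans ?_
    rw [hθ]
    refine MvPolynomial.totalDegree_finsetSum_le fun a _ => ?_
    refine (MvPolynomial.totalDegree_mul _ _).trans ?_
    have t1 := (hq a).2.2
    have t2 := totalDegree_aeval_le Y hYdeg (c a : Polynomial K)
    have t3 : (c a : Polynomial K).natDegree ≤ m - b := by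
      have := (c a).2
      rw [Polynomial.mem_degreeLT] at this
      by_cases h0 : (c a : Polynomial K) = 0
      · simp [h0]
      · rw [Polynomial.degree_eq_natDegree h0] at this
        have : (c a : Polynomial K).natDegree < m - b + 1 := by exact_mod_cast this
        omega
    omega
  have hdisj : (W1 ⊔ W2) ⊓ LinearMap.range θ = ⊥ := by
    rw [eq_bot_iff]
    rintro x ⟨hx, ⟨c, rfl⟩⟩
    have hc : c = 0 := by
      apply hker
      intro a
      obtain ⟨y, ⟨p, hp, rfl⟩, z, ⟨p', hp', rfl⟩, hyz⟩ := Submodule.mem_sup.mp hx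
      rw [← hyz]
      simp [h1 a.1 a.2, h2 a.1 a.2]
    simp [hc]
  have : Module.Finite K V := by rw [hV]; infer_instance
  have : Module.Finite K W1 := by rw [hW1]; infer_instance
  have : Module.Finite K W2 := by rw [hW2]; infer_instance
  have s1 := Submodule.finrank_sup_add_finrank_inf_eq W1 W2
  have s2 := Submodule.finrank_sup_add_finrank_inf_eq (W1 ⊔ W2) (LinearMap.range θ)
  rw [hdisj, finrank_bot, add_zero, rU] at s2
  have s3 : Module.finrank K ((W1 ⊔ W2) ⊔ LinearMap.range θ :
      Submodule K (MvPolynomial (Fin 3) K)) ≤ Module.finrank K V :=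
    Submodule.finrank_mono (sup_le (sup_le hW1V hW2V) hUV)
  rw [rV] at s3
  rw [r1, r2] at s1
  have key : b * (m - b + 1) + (m - d 0 + 1) * (m - d 1 + 1) * (m - d 2 + 1) +
      (m - e 0 + 1) * (m - e 1 + 1) * (m - e 2 + 1) ≤ (m + 1) * (m + 1) * (m + 1) +
      (m - d 0 - e 0 + 1) * (m - d 1 - e 1 + 1) * (m - d 2 - e 2 + 1) := by
    omega
  exact bezout_arith hm (hdD 0) (hdD 1) (hdD 2) (heE 0) (heE 1) (heE 2) key

/-- Existence of a low-degree polynomial vanishing on few lines. -/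
lemma exists_poly {T : Finset (Ln K)} {j : ℕ} (h : #T ≤ j ^ 2) :
    ∃ F : MvPolynomial (Fin 3) K, F ≠ 0 ∧ F.totalDegree ≤ 6 * j ∧ ∀ a ∈ T, phi a F = 0 := by
  classical
  have hdeg : ∀ P ∈ Box K (fun _ => 2 * j), P.totalDegree ≤ 6 * j := by
    intro P hP
    unfold Box at hP
    rw [MvPolynomial.mem_restrictSupport_iff] at hP
    rw [MvPolynomial.totalDegree, Finset.sup_le_iff]
    intro s hs
    have := hP hs
    have h0 := this 0
    have h1 := this 1
    have h2 := this 2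
    rw [Finsupp.sum_fintype _ _ (by simp), Fin.sum_univ_three]
    simp only at h0 h1 h2
    omega
  let ρ : Box K (fun _ => 2 * j) →ₗ[K] (T → Polynomial.degreeLT K (6 * j + 1)) :=
    LinearMap.pi fun a => LinearMap.codRestrict _ ((phi a.1).toLinearMap ∘ₗ Submodule.subtype _) (by
      intro P
      rw [Polynomial.mem_degreeLT]
      refine lt_of_le_of_lt Polynomial.degree_le_natDegree ?_
      have := (natDegree_phi a.1 P.1).trans (hdeg P.1 P.2)
      exact_mod_cast Nat.lt_succ_of_le this)
  have hlt : Module.finrank K (T → Polynomial.degreeLT K (6 * j + 1)) <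
      Module.finrank K (Box K (fun _ => 2 * j)) := by
    rw [finrank_Box, Module.finrank_pi_fintype]
    have : Module.finrank K (Polynomial.degreeLT K (6 * j + 1)) = 6 * j + 1 := by
      rw [(Polynomial.degreeLTEquiv K (6 * j + 1)).finrank_eq]; simp
    simp only [this, Finset.sum_const, Finset.card_univ, Fintype.card_coe, smul_eq_mul]
    nlinarith
  have hk := LinearMap.ker_ne_bot_of_finrank_lt (f := ρ) hlt
  obtain ⟨P, hP, hP0⟩ := Submodule.exists_mem_ne_zero_of_ne_bot hk
  refine ⟨P.1, fun h0 => hP0 (Subtype.ext h0), hdeg _ P.2, fun a ha => ?_⟩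
  have := congrFun (LinearMap.mem_ker.mp hP) ⟨a, ha⟩
  have := congrArg Subtype.val this
  simpa [ρ] using this

end bezout
end Rud


namespace Rud

section derivs

variable {K : Type*} [Field K]

open MvPolynomial in
lemma chain {S : Type*} [CommRing S] [Algebra K S] (φ : MvPolynomial (Fin 3) K →ₐ[K] S)
    (D : S →+ S) (hD : ∀ a b, D (a * b) = D a * b + a * D b)
    (hC : ∀ c : K, D (algebraMap K S c) = 0) (P : MvPolynomial (Fin 3) K) :
    D (φ P) = φ (pderiv 0 P) * D (φ (X 0)) + φ (pderiv 1 P) * D (φ (X 1)) +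
      φ (pderiv 2 P) * D (φ (X 2)) := by
  induction P using MvPolynomial.induction_on with
  | C c =>
    have : φ (C c) = algebraMap K S c := by
      rw [← MvPolynomial.algebraMap_eq, AlgHom.commutes]
    rw [this, hC]; simp
  | add P Q h1 h2 => simp only [map_add, h1, h2]; ring
  | mul_X P i h =>
    rw [map_mul, hD, h]
    simp only [Derivation.leibniz, smul_eq_mul, map_add, map_mul]
    fin_cases i <;> simp [MvPolynomial.pderiv_X] <;> ring

open MvPolynomial in
lemma totalDegree_pderiv_le (i : Fin 3) (P : MvPolynomial (Fin 3) K) :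
    (pderiv i P).totalDegree ≤ P.totalDegree - 1 := by
  rw [totalDegree, Finset.sup_le_iff]
  intro m hm
  rw [mem_support_iff, coeff_pderiv] at hm
  have h1 : m + Finsupp.single i 1 ∈ P.support := by
    rw [mem_support_iff]; intro h; rw [h] at hm; simp at hm
  have h2 := le_totalDegree h1
  rw [Finsupp.sum_add_index' (by simp) (by simp)] at h2
  simp at h2
  omega

open MvPolynomial in
lemma eq_C_of_pderiv {p : ℕ} [CharP K p] {F : MvPolynomial (Fin 3) K} (hD : F.totalDegree < p)
    (h : ∀ i, pderiv i F = 0) : F = C (coeff 0 F) := by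
  ext m
  rw [coeff_C]
  split_ifs with h0
  · rw [h0]
  · by_contra hm
    obtain ⟨i, hi⟩ : ∃ i, m i ≠ 0 := by
      by_contra! hh
      apply h0
      ext i; simp [hh]
    have h1 := coeff_pderiv (i := i) F (m - Finsupp.single i 1)
    have h2 : m - Finsupp.single i 1 + Finsupp.single i 1 = m := by
      apply tsub_add_cancel_of_le
      rw [Finsupp.single_le_iff]; omega
    rw [h i, coeff_zero, h2] at h1
    have h3 : (((m - Finsupp.single i 1 : Fin 3 →₀ ℕ) i : ℕ) : K) + 1 = ((m i : ℕ) : K) := by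
      have : (m - Finsupp.single i 1 : Fin 3 →₀ ℕ) i + 1 = m i := by
        simp; omega
      exact_mod_cast congrArg (Nat.cast (R := K)) this
    rw [h3] at h1
    have h4 := (mul_eq_zero.mp h1.symm).resolve_left hm
    rw [CharP.cast_eq_zero_iff K p] at h4
    have h5 : m i ≤ F.totalDegree := by
      have := degreeOf_le_totalDegree F i
      have h6 := monomial_le_degreeOf i (mem_support_iff.mpr hm)
      omega
    have := Nat.le_of_dvd (Nat.pos_of_ne_zero hi) h4
    omega

open MvPolynomial in
lemma not_dvd_pderiv {F : MvPolynomial (Fin 3) K} {i : Fin 3} (h : pderiv i F ≠ 0) :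
    ¬ F ∣ pderiv i F := by
  rintro ⟨Q, hQ⟩
  have hF : F ≠ 0 := by rintro rfl; simp at h
  have hQ0 : Q ≠ 0 := by rintro rfl; rw [hQ] at h; simp at h
  have h1 := totalDegree_mul_of_isDomain hF hQ0
  rw [← hQ] at h1
  have h2 := totalDegree_pderiv_le i F
  have h3 : F.totalDegree ≠ 0 := by
    intro h0
    rw [totalDegree_eq_zero_iff_eq_C] at h0
    rw [h0] at h; simp at h
  omega

open MvPolynomial in
/-- Flecnodal type polynomial for lines in planes z = const. -/
noncomputable def Gl (F : MvPolynomial (Fin 3) K) : MvPolynomial (Fin 3) K :=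
  pderiv 0 F ^ 2 * pderiv 1 (pderiv 1 F) - 2 * pderiv 1 (pderiv 0 F) * pderiv 0 F * pderiv 1 F
    + pderiv 0 (pderiv 0 F) * pderiv 1 F ^ 2

lemma totalDegree_Gl (F : MvPolynomial (Fin 3) K) : (Gl F).totalDegree ≤ 3 * F.totalDegree := by
  have h : ∀ i, (MvPolynomial.pderiv i F).totalDegree ≤ F.totalDegree := fun i =>
    (totalDegree_pderiv_le i F).trans (Nat.sub_le _ _)
  have h' : ∀ i j, (MvPolynomial.pderiv j (MvPolynomial.pderiv i F)).totalDegree ≤ F.totalDegree :=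
    fun i j => ((totalDegree_pderiv_le j _).trans (Nat.sub_le _ _)).trans (h i)
  have hmul : ∀ {P Q : MvPolynomial (Fin 3) K} {d e : ℕ}, P.totalDegree ≤ d → Q.totalDegree ≤ e →
      (P * Q).totalDegree ≤ d + e := fun hP hQ =>
    (MvPolynomial.totalDegree_mul _ _).trans (add_le_add hP hQ)
  have h2 : (2 : MvPolynomial (Fin 3) K).totalDegree ≤ 0 := by
    have := MvPolynomial.totalDegree_C (σ := Fin 3) (2 : K)
    rw [show (MvPolynomial.C (2 : K) : MvPolynomial (Fin 3) K) = 2 from map_ofNat _ 2] at this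
    omega
  unfold Gl
  simp only [sq]
  refine (MvPolynomial.totalDegree_add _ _).trans (max_le ?_ ?_)
  · refine (MvPolynomial.totalDegree_sub _ _).trans (max_le ?_ ?_)
    · refine (hmul (hmul (h _) (h _)) (h' _ _)).trans (by omega)
    · refine (hmul (hmul (hmul h2 (h' _ _)) (h _)) (h _)).trans (by omega)
  · refine (hmul (h' _ _) (hmul (h _) (h _))).trans (by omega)

open MvPolynomial in
lemma deriv_phi (a : Ln K) (P : MvPolynomial (Fin 3) K) :
    Polynomial.derivative (phi a P) = phi a (pderiv (if a.1 then 2 else 1) P) -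
      Polynomial.C a.2.2.1 * phi a (pderiv 0 P) := by
  have := chain (phi a) (Polynomial.derivative (R := K)).toAddMonoidHom
    (fun x y => Polynomial.derivative_mul) (fun c => Polynomial.derivative_C) P
  simp only [LinearMap.toAddMonoidHom_coe] at this
  rw [this, phi_X0, phi_X1, phi_X2]
  cases a.1 <;> simp <;> ring

lemma phi_Gl {F : MvPolynomial (Fin 3) K} {a : Ln K} (ha : a.1 = false) (h : phi a F = 0) :
    phi a (Gl F) = 0 := by
  have hd := fun P => deriv_phi a P
  simp only [ha, Bool.false_eq_true, if_false] at hd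
  have e1 := hd F
  rw [h, map_zero] at e1
  have e2 : phi a (MvPolynomial.pderiv 1 F) =
    Polynomial.C a.2.2.1 * phi a (MvPolynomial.pderiv 0 F) := by linear_combination -e1
  have e3 := congrArg Polynomial.derivative e2
  rw [Polynomial.derivative_C_mul, hd, hd] at e3
  have hcomm : MvPolynomial.pderiv 0 (MvPolynomial.pderiv 1 F) =
    MvPolynomial.pderiv 1 (MvPolynomial.pderiv 0 F) := by
    ext m
    simp only [MvPolynomial.coeff_pderiv]
    rw [add_right_comm]
    simp
    ring
  rw [hcomm] at e3
  unfold Gl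
  simp only [map_add, map_sub, map_mul, map_pow, map_ofNat]
  rw [e2]
  linear_combination (phi a (MvPolynomial.pderiv 0 F)) ^ 2 * e3

open Classical in
lemma bezout_case {T : Finset (Ln K)} (hT : Good T) {F G : MvPolynomial (Fin 3) K} (hF : Prime F)
    (hFG : ¬ F ∣ G) (h1 : ∀ a ∈ T, phi a F = 0) (b : Bool) (h2 : ∀ a ∈ T, a.1 = b → phi a G = 0)
    (hG : G.totalDegree ≤ 3 * F.totalDegree) :
    ∃ T' ⊆ T, #T' ≤ 36 * F.totalDegree ^ 2 ∧
      cr T T ≤ 6 * F.totalDegree * #T + cr T' T' := by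
  refine ⟨{a ∈ T | phi a G = 0}, Finset.filter_subset _ _, ?_, ?_⟩
  · have := bezout (hT.mono (Finset.filter_subset (fun a => phi a G = 0) T)) hF hFG
      (fun a ha => h1 a (Finset.mem_filter.mp ha).1) (fun a ha => (Finset.mem_filter.mp ha).2)
    refine this.trans ?_
    calc _ ≤ 12 * (F.totalDegree * (3 * F.totalDegree)) := by gcongr
      _ = _ := by ring
  · have hs := cr_split hT G
    have h0 : cr {a ∈ T | ¬ phi a G = 0} {a ∈ T | ¬ phi a G = 0} = 0 := by
      unfold cr
      apply Finset.sum_eq_zero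
      intro a ha
      rw [Finset.card_eq_zero, Finset.filter_eq_empty_iff]
      intro c hc hadj
      rw [Finset.mem_filter] at ha hc
      have ha' : a.1 ≠ b := fun h => ha.2 (h2 a ha.1 h)
      have hc' : c.1 ≠ b := fun h => hc.2 (h2 c hc.1 h)
      apply hadj.1
      cases h3 : a.1 <;> cases h4 : c.1 <;> cases b <;> simp_all
    rw [h0] at hs
    have h3 : #{a ∈ T | ¬ phi a G = 0} * G.totalDegree ≤ #T * (3 * F.totalDegree) :=
      Nat.mul_le_mul (Finset.card_le_card (Finset.filter_subset _ _)) hG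
    nlinarith

end derivs

section order

lemma order_lemma {R : Type*} [CommRing R] [IsDomain R] {p : ℕ} [CharP R p]
    {g a U W : Polynomial R} (hg : g.natDegree < p) (h0 : g.eval 0 = 0)
    (h1 : (Polynomial.derivative g).eval 0 = 0) (ha : a.eval 0 ≠ 0)
    (h : a * Polynomial.derivative (Polynomial.derivative g) =
      U * g + W * Polynomial.derivative g) : g = 0 := by
  by_contra hg0
  obtain ⟨q, hq, hnd⟩ := Polynomial.exists_eq_pow_rootMultiplicity_mul_and_not_dvd g hg0 0
  set e := g.rootMultiplicity 0 with he
  simp only [Polynomial.C_0, sub_zero] at hq hnd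
  have hq0 : q.eval 0 ≠ 0 := by
    intro h'; apply hnd
    rw [Polynomial.X_dvd_iff, Polynomial.coeff_zero_eq_eval_zero, h']
  have hele : e ≤ g.natDegree := by
    have hqne : q ≠ 0 := by rintro rfl; simp at hq0
    rw [hq, Polynomial.natDegree_mul (pow_ne_zero _ Polynomial.X_ne_zero) hqne,
      Polynomial.natDegree_X_pow]
    omega
  clear_value e
  obtain _ | _ | k := e
  · rw [hq] at h0; simp at h0; exact hq0 h0
  · rw [hq] at h1; simp at h1; exact hq0 h1
  · have hX : (Polynomial.X : Polynomial R) ^ k ≠ 0 := pow_ne_zero _ Polynomial.X_ne_zero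
    have d1 : Polynomial.derivative g = Polynomial.X ^ k * (Polynomial.X *
        (((k : Polynomial R) + 2) * q + Polynomial.X * Polynomial.derivative q)) := by
      rw [hq]
      simp only [Polynomial.derivative_mul, Polynomial.derivative_X_pow]
      simp
      ring
    have d2 : Polynomial.derivative (Polynomial.derivative g) = Polynomial.X ^ k *
        (((k : Polynomial R) + 2) * ((k : Polynomial R) + 1) * q + Polynomial.X * ((2 * ((k : Polynomial R) + 2)) *
          Polynomial.derivative q + Polynomial.X *
          Polynomial.derivative (Polynomial.derivative q))) := by
      have d1' : Polynomial.derivative g = Polynomial.X ^ (k + 1) *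
        (((k : Polynomial R) + 2) * q + Polynomial.X * Polynomial.derivative q) := by
        rw [d1]; ring
      rw [d1']
      simp only [Polynomial.derivative_mul, Polynomial.derivative_X_pow,
        Polynomial.derivative_add, Polynomial.derivative_natCast, Polynomial.derivative_X]
      simp
      ring
    rw [d2, d1, hq] at h
    have h2 : a * (((k : Polynomial R) + 2) * ((k : Polynomial R) + 1) * q + Polynomial.X * ((2 * ((k : Polynomial R) + 2)) *
          Polynomial.derivative q + Polynomial.X *
          Polynomial.derivative (Polynomial.derivative q))) = Polynomial.X * (U * Polynomial.X * q
          + W * (((k : Polynomial R) + 2) * q + Polynomial.X * Polynomial.derivative q)) := by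
      apply mul_left_cancel₀ hX
      linear_combination h
    have h3 := congrArg (Polynomial.eval 0) h2
    simp [hq0, ha] at h3
    have n1 : ((k + 2 : ℕ) : R) ≠ 0 := by
      rw [Ne, CharP.cast_eq_zero_iff R p]
      intro hd; have := Nat.le_of_dvd (by omega) hd; omega
    have n2 : ((k + 1 : ℕ) : R) ≠ 0 := by
      rw [Ne, CharP.cast_eq_zero_iff R p]
      intro hd; have := Nat.le_of_dvd (by omega) hd; omega
    push_cast at n1 n2
    tauto

end order
end Rud


namespace Rud

section special

variable {K : Type*} [Field K]

/-- Substitution: a moving line over the fixed line `m0`. -/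
noncomputable def psi (A0 M N : Polynomial K) (η : K) :
    MvPolynomial (Fin 3) K →ₐ[K] Polynomial (Polynomial K) :=
  MvPolynomial.aeval ![Polynomial.C A0 + Polynomial.C N * Polynomial.X,
    Polynomial.C (Polynomial.C η) + Polynomial.C M * Polynomial.X,
    Polynomial.C Polynomial.X]

noncomputable def zeta : Polynomial K →ₐ[K] MvPolynomial (Fin 3) K :=
  Polynomial.aeval (MvPolynomial.X 2)

lemma natDegree_psi (A0 M N : Polynomial K) (η : K) (P : MvPolynomial (Fin 3) K) :
    (psi A0 M N η P).natDegree ≤ P.totalDegree := by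
  unfold psi
  rw [MvPolynomial.aeval_def, MvPolynomial.eval₂_eq]
  refine Polynomial.natDegree_sum_le_of_forall_le _ _ fun d hd => ?_
  have h1 : ∀ c : K, algebraMap K (Polynomial (Polynomial K)) c =
    Polynomial.C (Polynomial.C c) := fun c => rfl
  rw [h1]
  refine (Polynomial.natDegree_C_mul_le _ _).trans ?_
  refine (Polynomial.natDegree_prod_le _ _).trans ?_
  refine le_trans ?_ (MvPolynomial.le_totalDegree hd)
  unfold Finsupp.sum
  refine Finset.sum_le_sum fun i _ => ?_
  refine Polynomial.natDegree_pow_le.trans ?_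
  have : (![Polynomial.C A0 + Polynomial.C N * Polynomial.X,
    Polynomial.C (Polynomial.C η) + Polynomial.C M * Polynomial.X,
    Polynomial.C Polynomial.X] i : Polynomial (Polynomial K)).natDegree ≤ 1 := by
    fin_cases i
    · simp only [Fin.zero_eta, Matrix.cons_val_zero]
      compute_degree
    · simp only [Fin.mk_one, Matrix.cons_val_one]
      refine (Polynomial.natDegree_add_le _ _).trans (max_le (by simp) ?_)
      refine (Polynomial.natDegree_C_mul_le _ _).trans (by simp)
    · simp
  nlinarith

lemma psi_X0 (A0 M N : Polynomial K) (η : K) : psi A0 M N η (MvPolynomial.X 0) =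
    Polynomial.C A0 + Polynomial.C N * Polynomial.X := by simp [psi]
lemma psi_X1 (A0 M N : Polynomial K) (η : K) : psi A0 M N η (MvPolynomial.X 1) =
    Polynomial.C (Polynomial.C η) + Polynomial.C M * Polynomial.X := by simp [psi]
lemma psi_X2 (A0 M N : Polynomial K) (η : K) : psi A0 M N η (MvPolynomial.X 2) =
    Polynomial.C Polynomial.X := by simp [psi]
lemma psi_C (A0 M N : Polynomial K) (η c : K) : psi A0 M N η (MvPolynomial.C c) =
    Polynomial.C (Polynomial.C c) := by
  unfold psi
  rw [MvPolynomial.aeval_C]; rfl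

lemma psi_zeta (A0 M N : Polynomial K) (η : K) (r : Polynomial K) :
    psi A0 M N η (zeta r) = Polynomial.C r := by
  unfold zeta
  rw [← Polynomial.aeval_algHom_apply, psi_X2]
  induction r using Polynomial.induction_on' with
  | add a b h1 h2 => rw [map_add, h1, h2, Polynomial.C_add]
  | monomial n a =>
    rw [Polynomial.aeval_monomial, ← Polynomial.C_mul_X_pow_eq_monomial, Polynomial.C_mul,
      Polynomial.C_pow]
    rfl

/-- Embedding of `K[z][y]`. -/
noncomputable def iota : Polynomial (Polynomial K) →+* MvPolynomial (Fin 3) K :=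
  Polynomial.eval₂RingHom (zeta (K := K) : Polynomial K →+* MvPolynomial (Fin 3) K) (MvPolynomial.X 1)

lemma iota_C (r : Polynomial K) : iota (Polynomial.C r) = zeta r := by simp [iota]
lemma iota_X : iota (K := K) Polynomial.X = MvPolynomial.X 1 := by simp [iota]

lemma psi_iota (A0 M N : Polynomial K) (η : K) (r : Polynomial (Polynomial K)) :
    psi A0 M N η (iota r) =
      r.comp (Polynomial.C (Polynomial.C η) + Polynomial.C M * Polynomial.X) := by
  induction r using Polynomial.induction_on' with
  | add a b h1 h2 => rw [map_add, map_add, h1, h2, Polynomial.add_comp]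
  | monomial n a =>
    rw [← Polynomial.C_mul_X_pow_eq_monomial, map_mul, map_pow, iota_C, iota_X, map_mul, map_pow,
      psi_zeta, psi_X1]
    simp

/-- The candidate surface. -/
noncomputable def Hs (A0 M N : Polynomial K) (η : K) : MvPolynomial (Fin 3) K :=
  zeta M * (MvPolynomial.X 0 - zeta A0) - zeta N * (MvPolynomial.X 1 - MvPolynomial.C η)

lemma psi_Hs (A0 M N : Polynomial K) (η : K) : psi A0 M N η (Hs A0 M N η) = 0 := by
  unfold Hs
  rw [map_sub, map_mul, map_mul, map_sub, map_sub, psi_zeta, psi_zeta, psi_zeta, psi_X0, psi_X1,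
    psi_C]
  ring

lemma pseudo (A0 M N : Polynomial K) (η : K) (P : MvPolynomial (Fin 3) K) :
    ∃ (d : ℕ) (Q : MvPolynomial (Fin 3) K) (r : Polynomial (Polynomial K)),
      zeta M ^ d * P = Hs A0 M N η * Q + iota r := by
  induction P using MvPolynomial.induction_on with
  | C c => exact ⟨0, 0, Polynomial.C (Polynomial.C c), by
      rw [iota_C]; simp [zeta, MvPolynomial.algebraMap_eq]⟩
  | add P1 P2 h1 h2 =>
    obtain ⟨d1, Q1, r1, h1⟩ := h1
    obtain ⟨d2, Q2, r2, h2⟩ := h2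
    refine ⟨d1 + d2, zeta M ^ d2 * Q1 + zeta M ^ d1 * Q2,
      Polynomial.C (M ^ d2) * r1 + Polynomial.C (M ^ d1) * r2, ?_⟩
    rw [map_add, map_mul, map_mul, iota_C, iota_C, map_pow, map_pow]
    linear_combination zeta M ^ d2 * h1 + zeta M ^ d1 * h2
  | mul_X P i h =>
    obtain ⟨d, Q, r, h⟩ := h
    fin_cases i
    · refine ⟨d + 1, zeta M * Q * MvPolynomial.X 0 + iota r,
        r * (Polynomial.C (M * A0) + Polynomial.C N * (Polynomial.X - Polynomial.C (Polynomial.C η))), ?_⟩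
      simp only [map_mul, map_add, map_sub, iota_C, iota_X]
      have : (zeta (Polynomial.C η) : MvPolynomial (Fin 3) K) = MvPolynomial.C η := by
        simp [zeta, MvPolynomial.algebraMap_eq]
      rw [this]
      simp only [Fin.zero_eta]
      unfold Hs at *
      linear_combination zeta M * MvPolynomial.X 0 * h
    · refine ⟨d, Q * MvPolynomial.X 1, r * Polynomial.X, ?_⟩
      simp only [map_mul, iota_X, Fin.mk_one]
      linear_combination MvPolynomial.X 1 * h
    · refine ⟨d, Q * MvPolynomial.X 2, r * Polynomial.C Polynomial.X, ?_⟩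
      simp only [map_mul, iota_C]
      have : (zeta Polynomial.X : MvPolynomial (Fin 3) K) = MvPolynomial.X 2 := by
        simp [zeta]
      rw [this]
      simp only [Fin.reduceFinMk]
      linear_combination MvPolynomial.X 2 * h

open MvPolynomial in
lemma special_dvd {p : ℕ} [CharP K p] {F : MvPolynomial (Fin 3) K} (hF : Prime F)
    (hD : F.totalDegree < p) (hG : F ∣ Gl F) {m0 : Ln K} (hm : m0.1 = true) (h0 : phi m0 F = 0)
    (hM : phi m0 (pderiv 0 F) ≠ 0) :
    F ∣ Hs (Polynomial.C m0.2.2.2 - Polynomial.C m0.2.2.1 * Polynomial.X)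
      (phi m0 (pderiv 0 F)) (- phi m0 (pderiv 1 F)) m0.2.1 := by
  set M := phi m0 (pderiv 0 F) with hMdef
  set N := - phi m0 (pderiv 1 F) with hNdef
  set A0 : Polynomial K := Polynomial.C m0.2.2.2 - Polynomial.C m0.2.2.1 * Polynomial.X with hA0
  set η := m0.2.1 with hη
  set ψ := psi A0 M N η with hψ
  have hev : ∀ P, (ψ P).eval 0 = phi m0 P := by
    intro P
    induction P using MvPolynomial.induction_on with
    | C c => rw [hψ, psi_C, phi_C]; simp
    | add P Q h1 h2 => rw [map_add, Polynomial.eval_add, h1, h2, map_add]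
    | mul_X P i h =>
      rw [map_mul, Polynomial.eval_mul, h, map_mul]
      congr 1
      fin_cases i
      · simp only [Fin.zero_eta]; rw [hψ, psi_X0, phi_X0]; simp [hA0]
      · simp only [Fin.mk_one]; rw [hψ, psi_X1, phi_X1, hm]; simp [hη]
      · simp only [Fin.reduceFinMk]; rw [hψ, psi_X2, phi_X2, hm]; simp
  have hder : ∀ P, Polynomial.derivative (ψ P) = ψ (pderiv 0 P) * Polynomial.C N +
      ψ (pderiv 1 P) * Polynomial.C M := by
    intro P
    have := chain ψ (Polynomial.derivative (R := Polynomial K)).toAddMonoidHom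
      (fun x y => Polynomial.derivative_mul) (fun c => Polynomial.derivative_C) P
    simp only [LinearMap.toAddMonoidHom_coe] at this
    rw [this, hψ, psi_X0, psi_X1, psi_X2]
    simp
  have hcomm : MvPolynomial.pderiv 0 (MvPolynomial.pderiv 1 F) =
    MvPolynomial.pderiv 1 (MvPolynomial.pderiv 0 F) := by
    ext m
    simp only [MvPolynomial.coeff_pderiv]
    rw [add_right_comm]
    simp
    ring
  have hg1 := hder F
  have hg2 : Polynomial.derivative (Polynomial.derivative (ψ F)) =
      ψ (pderiv 0 (pderiv 0 F)) * Polynomial.C N ^ 2 +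
      2 * ψ (pderiv 1 (pderiv 0 F)) * Polynomial.C N * Polynomial.C M +
      ψ (pderiv 1 (pderiv 1 F)) * Polynomial.C M ^ 2 := by
    rw [hg1, Polynomial.derivative_add, Polynomial.derivative_mul, Polynomial.derivative_mul,
      hder, hder, hcomm]
    simp only [Polynomial.derivative_C]
    ring
  obtain ⟨Q, hQ⟩ := hG
  have hψG : ψ (Gl F) = ψ F * ψ Q := by rw [hQ, map_mul]
  have hgz : ψ F = 0 := by
    refine order_lemma (p := p) (a := ψ (pderiv 0 F) ^ 2)
      (U := Polynomial.C M ^ 2 * ψ Q)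
      (W := 2 * Polynomial.C M * ψ (pderiv 1 (pderiv 0 F)) * ψ (pderiv 0 F) -
        ψ (pderiv 0 (pderiv 0 F)) * (Polynomial.derivative (ψ F) -
          2 * Polynomial.C N * ψ (pderiv 0 F)))
      (lt_of_le_of_lt (natDegree_psi _ _ _ _ _) hD) ?_ ?_ ?_ ?_
    · rw [hev, h0]
    · rw [hg1]
      simp only [Polynomial.eval_add, Polynomial.eval_mul, hev, Polynomial.eval_C]
      rw [← hMdef, hNdef]; ring
    · rw [Polynomial.eval_pow, hev]; exact pow_ne_zero _ hM
    · have hGe : ψ (Gl F) = ψ (pderiv 0 F) ^ 2 * ψ (pderiv 1 (pderiv 1 F)) -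
        2 * ψ (pderiv 1 (pderiv 0 F)) * ψ (pderiv 0 F) * ψ (pderiv 1 F)
        + ψ (pderiv 0 (pderiv 0 F)) * ψ (pderiv 1 F) ^ 2 := by
        unfold Gl
        simp only [map_add, map_sub, map_mul, map_pow, map_ofNat]
      rw [hg2, hg1]
      rw [hψG] at hGe
      linear_combination (-Polynomial.C M ^ 2) * hGe
  obtain ⟨d, Q, r, hp⟩ := pseudo A0 M N η F
  have h1 := congrArg ψ hp
  rw [map_mul, hgz, map_add, map_mul, hψ, psi_Hs, psi_iota] at h1
  have hr : r = 0 := by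
    have h2 : r.comp (Polynomial.C (Polynomial.C η) + Polynomial.C M * Polynomial.X) = 0 := by
      linear_combination -h1
    rw [Polynomial.comp_eq_zero_iff] at h2
    rcases h2 with h2 | ⟨_, h2⟩
    · exact h2
    · exfalso
      have := congrArg (fun q => Polynomial.coeff q 1) h2
      simp at this
      exact hM this
  rw [hr, map_zero, add_zero] at hp
  have hdv : F ∣ Hs A0 M N η * Q := ⟨zeta M ^ d, by rw [← hp]; ring⟩
  rcases hF.dvd_or_dvd hdv with h2 | ⟨Q', hQ'⟩
  · exact h2
  · exfalso
    have h3 : zeta M ^ d = Hs A0 M N η * Q' := by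
      apply mul_left_cancel₀ hF.ne_zero
      rw [hQ'] at hp
      linear_combination hp
    have h4 := congrArg ψ h3
    rw [map_mul, hψ, psi_Hs, map_pow, psi_zeta, zero_mul] at h4
    have h6 : Polynomial.C M = 0 := eq_zero_of_pow_eq_zero h4
    exact hM (Polynomial.C_eq_zero.mp h6)

lemma phi_zeta_true {a : Ln K} (h : a.1 = true) (r : Polynomial K) : phi a (zeta r) = r := by
  unfold zeta
  rw [← Polynomial.aeval_algHom_apply, phi_X2, h]
  simp

lemma phi_zeta_false {a : Ln K} (h : a.1 = false) (r : Polynomial K) :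
    phi a (zeta r) = Polynomial.C (r.eval a.2.1) := by
  unfold zeta
  rw [← Polynomial.aeval_algHom_apply, phi_X2, h]
  simp only [Bool.false_eq_true, if_false]
  rw [show (Polynomial.C a.2.1 : Polynomial K) = algebraMap K _ a.2.1 from rfl,
    Polynomial.aeval_algebraMap_apply]
  rfl

open Classical in
/-- At most `k` lines of the first family lie in a reg. type surface. -/
def Kh (T : Finset (Ln K)) (k : ℕ) : Prop := ∀ b0 b1 c0 c1 c2 : K,
  #{a ∈ T | a.1 = false ∧ - a.2.2.1 = b0 + b1 * a.2.1 ∧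
    a.2.2.2 = c0 + c1 * a.2.1 + c2 * a.2.2.1} ≤ k

open Classical in
lemma Kh.mono {T T' : Finset (Ln K)} {k : ℕ} (h : Kh T k) (hs : T' ⊆ T) : Kh T' k :=
  fun b0 b1 c0 c1 c2 => (Finset.card_le_card (Finset.filter_subset_filter _ hs)).trans
    (h b0 b1 c0 c1 c2)

open Classical in
lemma cr_two {T : Finset (Ln K)} {d : ℕ} (b : Bool) (h : #{a ∈ T | a.1 = b} ≤ d) :
    cr T T ≤ 2 * d * #T := by
  have hd : Disjoint {a ∈ T | a.1 = b} {a ∈ T | ¬ a.1 = b} :=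
    Finset.disjoint_filter_filter_not _ _ _
  have h1 := cr_self_union hd
  rw [Finset.filter_union_filter_not_eq] at h1
  have hz : ∀ U : Finset (Ln K), (∀ x ∈ U, ∀ y ∈ U, x.1 = y.1) → cr U U = 0 := by
    intro U hU
    unfold cr
    apply Finset.sum_eq_zero
    intro a ha
    rw [Finset.card_eq_zero, Finset.filter_eq_empty_iff]
    intro c hc hadj
    exact hadj.1 (hU a ha c hc)
  have h2 : cr {a ∈ T | ¬ a.1 = b} {a ∈ T | a.1 = b} ≤ #{a ∈ T | ¬ a.1 = b} * d :=
    cr_le_mul fun a _ => (Finset.card_le_card (Finset.filter_subset _ _)).trans h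
  have h3 : #{a ∈ T | ¬ a.1 = b} * d ≤ #T * d :=
    Nat.mul_le_mul_right _ (Finset.card_le_card (Finset.filter_subset _ _))
  rw [h1, hz, hz]
  · nlinarith
  · intro x hx y hy
    rw [Finset.mem_filter] at hx hy
    have := hx.2; have := hy.2
    cases b <;> simp_all
  · intro x hx y hy
    rw [Finset.mem_filter] at hx hy
    rw [hx.2, hy.2]

open Classical MvPolynomial in
lemma prime_case {p : ℕ} [CharP K p] {T : Finset (Ln K)} (hT : Good T) {k : ℕ} (hk : Kh T k)
    {F : MvPolynomial (Fin 3) K} (hF : Prime F) (hD : F.totalDegree < p)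
    (h1 : ∀ a ∈ T, phi a F = 0) :
    (∃ T' ⊆ T, #T' ≤ 36 * F.totalDegree ^ 2 ∧
      cr T T ≤ 6 * F.totalDegree * #T + cr T' T') ∨
      cr T T ≤ 6 * F.totalDegree * #T + 2 * k * #T := by
  have hb : ∀ (G : MvPolynomial (Fin 3) K), ¬ F ∣ G → ∀ b : Bool,
      (∀ a ∈ T, a.1 = b → phi a G = 0) → G.totalDegree ≤ 3 * F.totalDegree →
      (∃ T' ⊆ T, #T' ≤ 36 * F.totalDegree ^ 2 ∧
      cr T T ≤ 6 * F.totalDegree * #T + cr T' T') ∨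
      cr T T ≤ 6 * F.totalDegree * #T + 2 * k * #T := by
    intro G hG b h2 h3
    obtain ⟨T', hs, hc, hcr⟩ := bezout_case hT hF hG h1 b h2 h3
    exact Or.inl ⟨T', hs, hc, hcr⟩
  have hpd : ∀ i, (pderiv i F).totalDegree ≤ 3 * F.totalDegree := fun i =>
    (totalDegree_pderiv_le i F).trans (by omega)
  by_cases hG : F ∣ Gl F
  swap
  · exact hb _ hG false (fun a ha hf => phi_Gl hf (h1 a ha)) (totalDegree_Gl F)
  by_cases hFx : pderiv 0 F = 0
  · by_cases hFy : pderiv 1 F = 0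
    · have hFz : pderiv 2 F ≠ 0 := by
        intro hFz
        have hc := eq_C_of_pderiv hD (fun i => by fin_cases i <;> assumption)
        have hne : coeff 0 F ≠ 0 := by
          intro h; rw [h, map_zero] at hc; exact hF.ne_zero hc
        apply hF.not_isUnit
        rw [hc]
        exact (IsUnit.mk0 _ hne).map C
      refine hb _ (not_dvd_pderiv hFz) true (fun a ha hf => ?_) (hpd _)
      have := deriv_phi a F
      rw [h1 a ha, hFx, hf] at this
      simpa using this.symm
    · refine hb _ (not_dvd_pderiv hFy) false (fun a ha hf => ?_) (hpd _)
      have := deriv_phi a F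
      rw [h1 a ha, hFx, hf] at this
      simpa using this.symm
  by_cases hall : ∀ a ∈ T, a.1 = true → phi a (pderiv 0 F) = 0
  · exact hb _ (not_dvd_pderiv hFx) true hall (hpd _)
  push Not at hall
  obtain ⟨m0, hm0T, hm0, hM⟩ := hall
  have hdv := special_dvd hF hD hG hm0 (h1 m0 hm0T) hM
  have hDpos : 1 ≤ F.totalDegree := by
    by_contra h0
    have h0' : F.totalDegree = 0 := by omega
    rw [totalDegree_eq_zero_iff_eq_C] at h0'
    rw [h0'] at hFx; simp at hFx
  set M := phi m0 (pderiv 0 F) with hMdef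
  set N := - phi m0 (pderiv 1 F) with hNdef
  by_cases hm1 : ∃ m1 ∈ T, m1.1 = true ∧ m1 ≠ m0
  swap
  · push Not at hm1
    right
    have : #{a ∈ T | a.1 = true} ≤ 1 := by
      rw [Finset.card_le_one]
      intro a ha b hb
      rw [Finset.mem_filter] at ha hb
      rw [hm1 a ha.1 ha.2, hm1 b hb.1 hb.2]
    have := cr_two true this
    nlinarith
  obtain ⟨m1, hm1T, hm1, hne⟩ := hm1
  have hvan : ∀ a ∈ T, phi a (Hs (Polynomial.C m0.2.2.2 - Polynomial.C m0.2.2.1 * Polynomial.X)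
      M N m0.2.1) = 0 := by
    intro a ha
    obtain ⟨Q, hQ⟩ := hdv
    rw [hQ, map_mul, h1 a ha, zero_mul]
  have e1 := hvan m1 hm1T
  unfold Hs at e1
  simp only [map_sub, map_mul, phi_zeta_true hm1, phi_X0, phi_X1, phi_C, hm1, if_true,
    ] at e1
  have hη : m1.2.1 ≠ m0.2.1 := by
    intro h
    have hu := hT m1 hm1T m0 hm0T (by rw [hm1, hm0]) h
    rw [h, hu] at e1
    have e2 : M * Polynomial.C (m1.2.2.2 - m0.2.2.2) = 0 := by
      rw [Polynomial.C_sub]; linear_combination e1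
    have e3 := (mul_eq_zero.mp e2).resolve_left hM
    rw [Polynomial.C_eq_zero, sub_eq_zero] at e3
    apply hne
    obtain ⟨f, e, u, w⟩ := m0
    obtain ⟨f', e', u', w'⟩ := m1
    simp_all
  set δ := m1.2.1 - m0.2.1 with hδ
  have hδ0 : δ ≠ 0 := sub_ne_zero.mpr hη
  set β0 := (m1.2.2.2 - m0.2.2.2) / δ with hβ0
  set β1 := -(m1.2.2.1 - m0.2.2.1) / δ with hβ1
  set β : Polynomial K := Polynomial.C β0 + Polynomial.C β1 * Polynomial.X with hβ
  have eN : N = M * β := by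
    have hc0 : Polynomial.C β0 * Polynomial.C δ = Polynomial.C m1.2.2.2 - Polynomial.C m0.2.2.2 := by
      rw [← Polynomial.C_mul, hβ0, div_mul_cancel₀ _ hδ0, Polynomial.C_sub]
    have hc1 : Polynomial.C β1 * Polynomial.C δ =
        -(Polynomial.C m1.2.2.1 - Polynomial.C m0.2.2.1) := by
      rw [← Polynomial.C_mul, hβ1, div_mul_cancel₀ _ hδ0, Polynomial.C_neg, Polynomial.C_sub]
    have hcδ : Polynomial.C δ = Polynomial.C m1.2.1 - Polynomial.C m0.2.1 := by
      rw [hδ, Polynomial.C_sub]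
    have hCδ : (Polynomial.C δ : Polynomial K) ≠ 0 := by simpa using hδ0
    apply mul_left_cancel₀ hCδ
    rw [hβ]
    linear_combination -e1 - M * hc0 - M * Polynomial.X * hc1 + N * hcδ
  set H' : MvPolynomial (Fin 3) K := MvPolynomial.X 0 -
    zeta (Polynomial.C m0.2.2.2 - Polynomial.C m0.2.2.1 * Polynomial.X) -
    zeta β * (MvPolynomial.X 1 - MvPolynomial.C m0.2.1) with hH'
  have hH : Hs (Polynomial.C m0.2.2.2 - Polynomial.C m0.2.2.1 * Polynomial.X) M N m0.2.1 =
    zeta M * H' := by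
    unfold Hs
    rw [eN, map_mul]; ring
  rw [hH] at hdv
  have hdv' : F ∣ H' := by
    rcases hF.dvd_or_dvd hdv with ⟨Q, hQ⟩ | h
    · exfalso
      apply hM
      have := congrArg (phi m0) hQ
      rwa [phi_zeta_true hm0, map_mul, h1 m0 hm0T, zero_mul] at this
    · exact h
  right
  have hcard : #{a ∈ T | a.1 = false} ≤ k := by
    refine le_trans (Finset.card_le_card ?_) (hk β0 β1 m0.2.2.2 (-m0.2.2.1) m0.2.1)
    intro a ha
    rw [Finset.mem_filter] at ha ⊢
    refine ⟨ha.1, ha.2, ?_⟩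
    obtain ⟨Q, hQ⟩ := hdv'
    have e4 := congrArg (phi a) hQ
    rw [map_mul, h1 a ha.1, zero_mul, hH'] at e4
    simp only [map_sub, map_mul, phi_zeta_false ha.2, phi_X0, phi_X1, phi_C, ha.2,
      Bool.false_eq_true, if_false, hβ] at e4
    have c0 := congrArg (Polynomial.eval 0) e4
    have c1 := congrArg (Polynomial.eval 1) e4
    simp only [Polynomial.eval_sub, Polynomial.eval_mul, Polynomial.eval_C, Polynomial.eval_X,
      Polynomial.eval_add, Polynomial.eval_zero] at c0 c1
    clear_value β0 β1
    constructor
    · linear_combination c1 - c0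
    · linear_combination c0 + m0.2.1 * (c1 - c0)
  have := cr_two false hcard
  nlinarith

end special
end Rud


namespace Rud

section inc

variable {K : Type*} [Field K]

open Classical in
lemma fact_case {p k n0 : ℕ} [CharP K p]
    (IH : ∀ T : Finset (Ln K), Good T → Kh T k → #T < n0 →
      (cr T T : ℝ) ≤ 10 ^ 8 * (#T * √(#T) + k * #T))
    (F : MvPolynomial (Fin 3) K) : F ≠ 0 → F.totalDegree < p → 36 * F.totalDegree ^ 2 < n0 →
    ∀ T : Finset (Ln K), Good T → Kh T k → #T ≤ n0 → (∀ a ∈ T, phi a F = 0) →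
    (cr T T : ℝ) ≤ 8 * F.totalDegree * n0 + 10 ^ 8 * k * #T +
      216 * 10 ^ 8 * (F.totalDegree : ℝ) ^ 3 := by
  induction F using UniqueFactorizationMonoid.induction_on_prime with
  | h₁ => intro h; exact absurd rfl h
  | h₂ F hF =>
    intro _ _ _ T _ _ _ hz
    have : T = ∅ := by
      rw [Finset.eq_empty_iff_forall_notMem]
      intro a ha
      have h1 := hF.map (phi a)
      rw [hz a ha] at h1
      exact not_isUnit_zero h1
    rw [this]
    simp only [cr, Finset.sum_empty, Nat.cast_zero]
    positivity
  | h₃ F q hF0 hq ih =>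
    intro hne hD hD2 T hT hk hn hz
    have hdeg : (q * F).totalDegree = q.totalDegree + F.totalDegree :=
      MvPolynomial.totalDegree_mul_of_isDomain hq.ne_zero hF0
    rw [hdeg] at hD hD2 ⊢
    set dq := q.totalDegree with hdq
    set dF := F.totalDegree with hdF
    have hs := cr_split hT q
    have hcard := Finset.card_filter_add_card_filter_not (s := T) (fun a => phi a q = 0)
    set T0 := ({a ∈ T | phi a q = 0} : Finset (Ln K)) with hT0
    set T1 := ({a ∈ T | ¬ phi a q = 0} : Finset (Ln K)) with hT1
    have s0 : T0 ⊆ T := Finset.filter_subset _ _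
    have s1 : T1 ⊆ T := Finset.filter_subset _ _
    have h1 := ih hF0 (by omega) (lt_of_le_of_lt (by gcongr; omega) hD2) T1 (hT.mono s1)
      (hk.mono s1) (by omega) (by
        intro a ha
        rw [hT1, Finset.mem_filter] at ha
        have := hz a ha.1
        rw [map_mul] at this
        exact (mul_eq_zero.mp this).resolve_left ha.2)
    have hz0 : ∀ a ∈ T0, phi a q = 0 := fun a ha => (Finset.mem_filter.mp ha).2
    have h0 : (cr T0 T0 : ℝ) ≤ 6 * dq * #T0 + 10 ^ 8 * k * #T0 + 216 * 10 ^ 8 * (dq : ℝ) ^ 3 := by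
      rcases prime_case (hT.mono s0) (hk.mono s0) hq (by omega : q.totalDegree < p) hz0 with
        ⟨T', hs', hc', hcr'⟩ | hcr
      · have hlt : #T' < n0 := by
          refine lt_of_le_of_lt hc' (lt_of_le_of_lt ?_ hD2)
          gcongr; omega
        have h2 := IH T' ((hT.mono s0).mono hs') ((hk.mono s0).mono hs') hlt
        have h3 : (#T' : ℝ) ≤ 36 * (dq : ℝ) ^ 2 := by exact_mod_cast hc'
        have h4 : √(#T' : ℝ) ≤ 6 * dq := by
          rw [Real.sqrt_le_left (by positivity)]
          nlinarith
        have h5 : (#T' : ℝ) * √(#T') ≤ 216 * (dq : ℝ) ^ 3 := by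
          calc (#T' : ℝ) * √(#T') ≤ (36 * (dq : ℝ) ^ 2) * (6 * dq) := by gcongr
            _ = _ := by ring
        have h6 : (#T' : ℝ) ≤ #T0 := by exact_mod_cast Finset.card_le_card hs'
        have h7 : (k : ℝ) * #T' ≤ k * #T0 := by gcongr
        have h8 : (cr T0 T0 : ℝ) ≤ 6 * dq * #T0 + cr T' T' := by exact_mod_cast hcr'
        linarith
      · have h8 : (cr T0 T0 : ℝ) ≤ 6 * dq * #T0 + 2 * k * #T0 := by exact_mod_cast hcr
        have h9 : (0 : ℝ) ≤ k * #T0 := by positivity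
        have h10 : (0 : ℝ) ≤ (dq : ℝ) ^ 3 := by positivity
        linarith
    have hs' : (cr T T : ℝ) ≤ cr T0 T0 + cr T1 T1 + 2 * (#T1 * dq) := by exact_mod_cast hs
    have hcard' : (#T0 : ℝ) + #T1 = #T := by exact_mod_cast hcard
    have hn' : (#T : ℝ) ≤ n0 := by exact_mod_cast hn
    have q1 : (0 : ℝ) ≤ dq * (n0 - #T0) := by
      apply mul_nonneg (by positivity)
      have : (0 : ℝ) ≤ #T1 := by positivity
      linarith
    have q2 : (0 : ℝ) ≤ dq * (n0 - #T1) := by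
      apply mul_nonneg (by positivity)
      have : (0 : ℝ) ≤ #T0 := by positivity
      linarith
    have q3 : (k : ℝ) * #T = k * #T0 + k * #T1 := by rw [← hcard']; ring
    have q4 : (0 : ℝ) ≤ (dq : ℝ) ^ 2 * dF := by positivity
    have q5 : (0 : ℝ) ≤ (dF : ℝ) ^ 2 * dq := by positivity
    push_cast
    nlinarith

lemma cr_trivial (T : Finset (Ln K)) : cr T T ≤ #T * #T := by
  classical
  exact cr_le_mul fun a _ => Finset.card_le_card (Finset.filter_subset _ _)

set_option maxHeartbeats 1000000 in
open Classical in
theorem main_inc {p k : ℕ} [CharP K p] (n : ℕ) : ∀ T : Finset (Ln K), #T = n → Good T → Kh T k →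
    (n : ℝ) ≤ 10 ^ 6 * (p : ℝ) ^ 2 → (cr T T : ℝ) ≤ 10 ^ 8 * (#T * √(#T) + k * #T) := by
  induction n using Nat.strong_induction_on with
  | _ n ih =>
  intro T hTn hT hk hnp
  have hk0 : (0 : ℝ) ≤ k * #T := by positivity
  set s := √(n : ℝ) with hs
  have hs0 : 0 ≤ s := Real.sqrt_nonneg _
  have hss : s * s = n := Real.mul_self_sqrt (by positivity)
  by_cases hsmall : s < 10 ^ 5
  · have h1 : (cr T T : ℝ) ≤ (n : ℝ) * n := by
      have := cr_trivial T
      rw [hTn] at this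
      exact_mod_cast this
    rw [hTn, ← hs] at *
    have h2 : (n : ℝ) * n ≤ 10 ^ 5 * (n * s) := by
      have : (n : ℝ) * n = (n * s) * s := by rw [mul_assoc, hss]
      rw [this]
      have : (0 : ℝ) ≤ n * s := by positivity
      nlinarith
    have : (0 : ℝ) ≤ n * s := by positivity
    linarith
  push Not at hsmall
  set j := ⌊s / 10 ^ 5⌋₊ with hj
  have hj1 : (1 : ℝ) ≤ j := by
    have : 1 ≤ j := by
      rw [hj, Nat.one_le_floor_iff]
      rw [le_div_iff₀ (by norm_num)]; linarith
    exact_mod_cast this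
  have hjle : (j : ℝ) * 10 ^ 5 ≤ s := by
    have := Nat.floor_le (a := s / 10 ^ 5) (by positivity)
    rwa [le_div_iff₀ (by norm_num)] at this
  have hjge : s ≤ 2 * 10 ^ 5 * j := by
    have := Nat.lt_floor_add_one (s / 10 ^ 5)
    rw [div_lt_iff₀ (by norm_num), ← hj] at this
    linarith
  have hjn : (j : ℝ) ^ 2 * 10 ^ 10 ≤ n := by rw [← hss]; nlinarith
  have hjn' : j ^ 2 ≤ #T := by
    rw [hTn]
    have : (j : ℝ) ^ 2 ≤ n := by nlinarith
    exact_mod_cast this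
  obtain ⟨U, hUT, hUc⟩ := Finset.exists_subset_card_eq hjn'
  obtain ⟨F, hF0, hFd, hFU⟩ := exists_poly (T := U) (j := j) hUc.le
  have hFd' : (F.totalDegree : ℝ) ≤ 6 * j := by exact_mod_cast hFd
  set D := F.totalDegree with hD
  have hDp : D < p := by
    have h1 : s ≤ 10 ^ 3 * p := by
      rw [hs, Real.sqrt_le_left (by positivity)]; nlinarith
    have : (D : ℝ) < p := by nlinarith
    exact_mod_cast this
  have hD2 : 36 * D ^ 2 < n := by
    have : (36 : ℝ) * (D : ℝ) ^ 2 < n := by nlinarith [Nat.cast_nonneg (α := ℝ) D]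
    exact_mod_cast this
  have IH : ∀ T : Finset (Ln K), Good T → Kh T k → #T < n →
      (cr T T : ℝ) ≤ 10 ^ 8 * (#T * √(#T) + k * #T) := by
    intro T' h1 h2 h3
    refine ih _ h3 T' rfl h1 h2 (le_trans ?_ hnp)
    exact_mod_cast h3.le
  have hspl := cr_split hT F
  have hcard := Finset.card_filter_add_card_filter_not (s := T) (fun a => phi a F = 0)
  have hb : j ^ 2 ≤ #({a ∈ T | phi a F = 0}) := by
    rw [← hUc]
    apply Finset.card_le_card
    intro a ha
    exact Finset.mem_filter.mpr ⟨hUT ha, hFU a ha⟩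
  set T0 := ({a ∈ T | phi a F = 0} : Finset (Ln K)) with hT0
  set T1 := ({a ∈ T | ¬ phi a F = 0} : Finset (Ln K)) with hT1
  have s0 : T0 ⊆ T := Finset.filter_subset _ _
  have s1 : T1 ⊆ T := Finset.filter_subset _ _
  have hj0 : 1 ≤ j ^ 2 := by
    have : 1 ≤ j := by exact_mod_cast hj1
    nlinarith
  have c0 := fact_case IH F hF0 hDp hD2 T0 (hT.mono s0) (hk.mono s0) (by omega)
    (fun a ha => (Finset.mem_filter.mp ha).2)
  have c1 := IH T1 (hT.mono s1) (hk.mono s1) (by omega)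
  have hspl' : (cr T T : ℝ) ≤ cr T0 T0 + cr T1 T1 + 2 * (#T1 * D) := by exact_mod_cast hspl
  have hcard' : (#T0 : ℝ) + #T1 = n := by rw [← hTn]; exact_mod_cast hcard
  have hb' : (j : ℝ) ^ 2 ≤ #T0 := by exact_mod_cast hb
  rw [hTn, ← hs]
  have e1 : (#T1 : ℝ) * √(#T1) ≤ n * s - (j : ℝ) ^ 2 * s := by
    have h1 : √(#T1 : ℝ) ≤ s := by
      apply Real.sqrt_le_sqrt
      have : (0 : ℝ) ≤ #T0 := by positivity
      linarith
    calc (#T1 : ℝ) * √(#T1) ≤ (n - (j : ℝ) ^ 2) * s := by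
          apply mul_le_mul (by linarith) h1 (Real.sqrt_nonneg _)
          have : (0 : ℝ) ≤ #T1 := by positivity
          linarith
      _ = _ := by ring
  have e2 : (k : ℝ) * n = k * #T0 + k * #T1 := by rw [← hcard']; ring
  have e3 : (D : ℝ) * n ≤ 6 * j * n := by gcongr
  have e4 : (#T1 : ℝ) * D ≤ 6 * j * n := by
    rw [mul_comm]
    gcongr
    have : (0 : ℝ) ≤ #T0 := by positivity
    linarith
  have e5 : (D : ℝ) ^ 3 ≤ 216 * (j : ℝ) ^ 3 := by
    calc (D : ℝ) ^ 3 ≤ (6 * j) ^ 3 := by gcongr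
      _ = _ := by ring
  have e6 : (j : ℝ) * n ≤ 2 * 10 ^ 5 * ((j : ℝ) ^ 2 * s) := by
    rw [← hss]
    have : (0 : ℝ) ≤ j * s := by positivity
    nlinarith
  have e7 : (j : ℝ) ^ 3 * 10 ^ 5 ≤ (j : ℝ) ^ 2 * s := by
    have : (0 : ℝ) ≤ (j : ℝ) ^ 2 := by positivity
    nlinarith
  have e8 : (0 : ℝ) ≤ (j : ℝ) ^ 2 * s := by positivity
  linarith only [hspl', c0, c1, e1, e2, e3, e4, e5, e6, e7, e8]

end inc
end Rud


namespace Rud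

section app

variable {p : ℕ} [Fact p.Prime]


lemma exists_lam (p : ℕ) [Fact p.Prime] : ∃ lam : AlgebraicClosure (ZMod p), ∀ a b : ZMod p,
    algebraMap _ (AlgebraicClosure (ZMod p)) a + lam * algebraMap _ _ b = 0 → b = 0 := by
  have : ¬ Function.Surjective (algebraMap (ZMod p) (AlgebraicClosure (ZMod p))) := by
    intro h
    have : Infinite (AlgebraicClosure (ZMod p)) := IsAlgClosed.instInfinite
    exact not_finite_iff_infinite.mpr this (Finite.of_surjective _ h)
  rw [Function.Surjective] at this
  push Not at this
  obtain ⟨lam, hl⟩ := this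
  refine ⟨lam, fun a b h => ?_⟩
  by_contra hb
  apply hl (-a / b)
  have hb' : algebraMap _ (AlgebraicClosure (ZMod p)) b ≠ 0 := by simpa using hb
  rw [map_div₀, map_neg, div_eq_iff hb']
  linear_combination -h

open Classical in
theorem inc_Fp (X : Finset (ZMod p × ZMod p × ZMod p)) (k : ℕ)
    (hA : #(X.image Prod.fst) ≤ k)
    (hB : ∀ (s : ZMod p) (α β : AlgebraicClosure (ZMod p)),
      #{τ ∈ X | τ.1 = s ∧ algebraMap _ (AlgebraicClosure (ZMod p)) τ.2.2 =
        α + β * algebraMap _ _ τ.2.1} ≤ k)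
    (hn : (2 * #X : ℝ) ≤ 10 ^ 6 * (p : ℝ) ^ 2) :
    (#{q ∈ X ×ˢ X | q.1.2.2 - q.2.2.2 = q.1.2.1 * q.2.1 - q.2.2.1 * q.1.1} : ℝ) ≤
      10 ^ 8 * (2 * #X * √(2 * #X) + k * (2 * #X)) := by
  obtain ⟨lam, hlam⟩ := exists_lam p
  have : CharP (AlgebraicClosure (ZMod p)) p := charP_of_injective_algebraMap (algebraMap (ZMod p) (AlgebraicClosure (ZMod p))).injective p
  set ι := algebraMap (ZMod p) (AlgebraicClosure (ZMod p)) with hι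
  have hinj : Function.Injective ι := ι.injective
  have hlam2 : ∀ a b a' b' : ZMod p, ι a + lam * ι b = ι a' + lam * ι b' → a = a' ∧ b = b' := by
    intro a b a' b' h
    have h1 := hlam (a - a') (b - b') (by rw [map_sub, map_sub]; linear_combination h)
    have h2 : b = b' := sub_eq_zero.mp h1
    subst h2
    exact ⟨hinj (by linear_combination h), rfl⟩
  let ln : Bool → ZMod p × ZMod p × ZMod p → Ln (AlgebraicClosure (ZMod p)) := fun f τ =>
    (f, ι τ.1 + lam * ι τ.2.1, ι τ.2.1, ι τ.2.2)
  have hln : ∀ f, Function.Injective (ln f) := by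
    rintro f ⟨s, u, w⟩ ⟨s', u', w'⟩ h
    simp only [ln, Prod.mk.injEq, true_and] at h
    obtain ⟨h1, h2⟩ := hlam2 _ _ _ _ h.1
    rw [h1, h2, hinj h.2.2]
  set T := X.image (ln false) ∪ X.image (ln true) with hT
  have hmem : ∀ a ∈ T, ∃ f, ∃ τ ∈ X, a = ln f τ := by
    intro a ha
    rw [hT, Finset.mem_union, Finset.mem_image, Finset.mem_image] at ha
    rcases ha with ⟨τ, h1, h2⟩ | ⟨τ, h1, h2⟩
    · exact ⟨_, τ, h1, h2.symm⟩
    · exact ⟨_, τ, h1, h2.symm⟩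
  have hdisj : Disjoint (X.image (ln false)) (X.image (ln true)) := by
    rw [Finset.disjoint_left]
    intro a ha hb
    rw [Finset.mem_image] at ha hb
    obtain ⟨τ, _, rfl⟩ := ha
    obtain ⟨τ', _, h⟩ := hb
    simp [ln] at h
  have hcT : #T = 2 * #X := by
    rw [hT, Finset.card_union_of_disjoint hdisj, Finset.card_image_of_injective _ (hln _),
      Finset.card_image_of_injective _ (hln _)]
    ring
  have hgood : Good T := by
    intro a ha b hb h1 h2
    obtain ⟨f, τ, _, rfl⟩ := hmem a ha
    obtain ⟨f', τ', _, rfl⟩ := hmem b hb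
    simp only [ln] at h2 ⊢
    rw [(hlam2 _ _ _ _ h2).2]
  have hKh : Kh T k := by
    intro b0 b1 c0 c1 c2
    have hle : #{a ∈ T | a.1 = false ∧ - a.2.2.1 = b0 + b1 * a.2.1 ∧
        a.2.2.2 = c0 + c1 * a.2.1 + c2 * a.2.2.1} ≤
        #{τ ∈ X | - ι τ.2.1 = b0 + b1 * (ι τ.1 + lam * ι τ.2.1) ∧
          ι τ.2.2 = c0 + c1 * (ι τ.1 + lam * ι τ.2.1) + c2 * ι τ.2.1} := by
      rw [← Finset.card_image_of_injective _ (hln false)]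
      apply Finset.card_le_card
      intro a ha
      rw [Finset.mem_filter] at ha
      obtain ⟨f, τ, hτ, rfl⟩ := hmem a ha.1
      simp only [ln] at ha
      obtain ⟨_, rfl, h1, h2⟩ := ha
      rw [Finset.mem_image]
      exact ⟨τ, Finset.mem_filter.mpr ⟨hτ, h1, h2⟩, rfl⟩
    refine hle.trans ?_
    by_cases hb : 1 + b1 * lam = 0
    · have hb1 : b1 ≠ 0 := by rintro rfl; simp at hb
      by_cases hs : ∃ s : ZMod p, ι s = -b0 / b1
      · obtain ⟨s, hs⟩ := hs
        refine le_trans (Finset.card_le_card ?_) (hB s (c0 + c1 * ι s) (c1 * lam + c2))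
        intro τ hτ
        rw [Finset.mem_filter] at hτ ⊢
        obtain ⟨h0, h1, h2⟩ := hτ
        have h3 : τ.1 = s := by
          apply hinj
          rw [hs, eq_div_iff hb1]
          linear_combination -h1 - ι τ.2.1 * hb
        refine ⟨h0, h3, ?_⟩
        rw [h2, h3]; ring
      · have : ({τ ∈ X | - ι τ.2.1 = b0 + b1 * (ι τ.1 + lam * ι τ.2.1) ∧
          ι τ.2.2 = c0 + c1 * (ι τ.1 + lam * ι τ.2.1) + c2 * ι τ.2.1} : Finset _) = ∅ := by
          rw [Finset.filter_eq_empty_iff]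
          rintro τ hτ ⟨h1, h2⟩
          apply hs
          refine ⟨τ.1, ?_⟩
          rw [eq_div_iff hb1]
          linear_combination -h1 - ι τ.2.1 * hb
        rw [this]; simp
    · refine le_trans ?_ hA
      refine Finset.card_le_card_of_injOn Prod.fst ?_ ?_
      · intro τ hτ
        rw [Finset.mem_coe, Finset.mem_filter] at hτ
        exact Finset.mem_image_of_mem _ hτ.1
      · rintro ⟨s, u, w⟩ h1 ⟨s', u', w'⟩ h2 h
        rw [Finset.mem_coe, Finset.mem_filter] at h1 h2
        simp only at h h1 h2
        subst h
        have hu : u = u' := by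
          apply hinj
          apply mul_left_cancel₀ hb
          linear_combination h2.2.1 - h1.2.1
        subst hu
        have hw : w = w' := hinj (by rw [h1.2.2, h2.2.2])
        rw [hw]
  have hmain := main_inc (p := p) (k := k) (#T) T rfl hgood hKh (by rw [hcT]; exact_mod_cast hn)
  rw [hcT] at hmain
  push_cast at hmain
  refine le_trans ?_ hmain
  norm_cast
  -- counting
  rw [Finset.card_filter, Finset.sum_product]
  calc ∑ x ∈ X, ∑ y ∈ X, (if x.2.2 - y.2.2 = x.2.1 * y.1 - y.2.1 * x.1 then 1 else 0)
      ≤ ∑ x ∈ X, #{b ∈ T | Adj (ln false x) b} := by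
        refine Finset.sum_le_sum fun x hx => ?_
        rw [← Finset.card_filter, ← Finset.card_image_of_injective _ (hln true)]
        apply Finset.card_le_card
        intro a ha
        rw [Finset.mem_image] at ha
        obtain ⟨y, hy, rfl⟩ := ha
        rw [Finset.mem_filter] at hy ⊢
        refine ⟨?_, ?_⟩
        · rw [hT, Finset.mem_union]; right; exact Finset.mem_image_of_mem _ hy.1
        · refine ⟨by simp [ln], ?_⟩
          simp only [ln]
          have := congrArg ι hy.2
          simp only [map_sub, map_mul] at this
          linear_combination this
    _ = ∑ a ∈ X.image (ln false), #{b ∈ T | Adj a b} := by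
        rw [Finset.sum_image fun x _ y _ h => hln _ h]
    _ ≤ cr T T := by
        unfold cr
        exact Finset.sum_le_sum_of_subset Finset.subset_union_left

end app
end Rud


namespace Rud

section core

lemma quad_card {F : Type*} [Field F] (s : Finset F) (α β γ : F) (h : α ≠ 0 ∨ β ≠ 0)
    (hs : ∀ x ∈ s, α * x ^ 2 + β * x + γ = 0) : #s ≤ 2 := by
  classical
  set P : Polynomial F := Polynomial.C α * Polynomial.X ^ 2 + Polynomial.C β * Polynomial.X +
    Polynomial.C γ with hP
  have hP0 : P ≠ 0 := by
    intro h0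
    have h1 := congrArg (fun q => Polynomial.coeff q 2) h0
    have h2 := congrArg (fun q => Polynomial.coeff q 1) h0
    simp [hP, Polynomial.coeff_X, Polynomial.coeff_C] at h1 h2
    tauto
  have hsub : s ⊆ P.roots.toFinset := by
    intro x hx
    rw [Multiset.mem_toFinset, Polynomial.mem_roots hP0, Polynomial.IsRoot, hP]
    simpa using hs x hx
  calc #s ≤ #P.roots.toFinset := Finset.card_le_card hsub
    _ ≤ Multiset.card P.roots := Multiset.toFinset_card_le _
    _ ≤ P.natDegree := Polynomial.card_roots' P
    _ ≤ 2 := by rw [hP]; exact Polynomial.natDegree_quadratic_le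

variable {p : ℕ} [Fact p.Prime]

/-- The quadratic polynomial function. -/
def quad (a b c d e g x y : ZMod p) : ZMod p :=
  a * x ^ 2 + b * x * y + c * y ^ 2 + d * x + e * y + g

/-- The parametrization of lines. -/
def Phi (a b c d e : ZMod p) (t : ZMod p × ZMod p × ZMod p) : ZMod p × ZMod p × ZMod p :=
  (t.1, b * t.2.2 - 2 * a * t.2.1, a * t.1 ^ 2 + d * t.1 -
    (a * t.2.1 ^ 2 - b * t.2.1 * t.2.2 + c * t.2.2 ^ 2 - d * t.2.1 + e * t.2.2))

lemma two_ne (hp : 2 < p) : (2 : ZMod p) ≠ 0 := by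
  intro h
  have h' : ((2 : ℕ) : ZMod p) = 0 := by exact_mod_cast h
  rw [ZMod.natCast_eq_zero_iff] at h'
  exact absurd (Nat.le_of_dvd (by norm_num) h') (by omega)

open Classical in
lemma fiber_Phi (hp : 2 < p) {a b c d e : ZMod p}
    (hnd : (a ≠ 0 ∧ (b ^ 2 - 4 * a * c ≠ 0 ∨ 4 * a * e - 2 * b * d ≠ 0)) ∨ (a = 0 ∧ b ≠ 0))
    (Dom : Finset (ZMod p × ZMod p × ZMod p)) (hDom : ∀ t ∈ Dom, a ≠ 0 ∨ b * t.2.2 + d ≠ 0)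
    (τ : ZMod p × ZMod p × ZMod p) : #{t ∈ Dom | Phi a b c d e t = τ} ≤ 2 := by
  obtain ⟨s0, u0, w0⟩ := τ
  have h2 := two_ne hp
  rcases hnd with ⟨ha, hnd⟩ | ⟨ha, hb⟩
  · have hinj : Set.InjOn (fun t : ZMod p × ZMod p × ZMod p => t.2.2)
        ({t ∈ Dom | Phi a b c d e t = (s0, u0, w0)} : Finset _) := by
      rintro ⟨s, y, z⟩ ht ⟨s', y', z'⟩ ht' h
      rw [Finset.mem_coe, Finset.mem_filter] at ht ht'
      simp only [Phi, Prod.mk.injEq] at ht ht' h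
      obtain ⟨_, rfl, h3, _⟩ := ht
      obtain ⟨_, rfl, h4, _⟩ := ht'
      subst h
      have : y = y' := by
        apply mul_left_cancel₀ (mul_ne_zero h2 ha)
        linear_combination h4 - h3
      rw [this]
    rw [← Finset.card_image_of_injOn hinj]
    refine quad_card _ (-(b ^ 2 - 4 * a * c)) (4 * a * e - 2 * b * d)
      (u0 ^ 2 + 2 * d * u0 - 4 * a * (a * s0 ^ 2 + d * s0 - w0)) (by
        rcases hnd with h | h
        · left; exact neg_ne_zero.mpr h
        · right; exact h) ?_
    intro z hz
    rw [Finset.mem_image] at hz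
    obtain ⟨⟨s, y, z'⟩, ht, rfl⟩ := hz
    rw [Finset.mem_filter] at ht
    simp only [Phi, Prod.mk.injEq] at ht
    obtain ⟨_, rfl, h3, h4⟩ := ht
    rw [← h3, ← h4]
    ring
  · have : #{t ∈ Dom | Phi a b c d e t = (s0, u0, w0)} ≤ 1 := by
      rw [Finset.card_le_one]
      rintro ⟨s, y, z⟩ ht ⟨s', y', z'⟩ ht'
      rw [Finset.mem_filter] at ht ht'
      have hd := hDom _ ht.1
      simp only [Phi, Prod.mk.injEq] at ht ht' hd
      obtain ⟨_, rfl, h3, h3'⟩ := ht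
      obtain ⟨_, rfl, h4, h4'⟩ := ht'
      subst ha
      have hz : z = z' := by
        apply mul_left_cancel₀ hb
        linear_combination h3 - h4
      subst hz
      have hd' : b * z + d ≠ 0 := by simpa using hd
      have : y = y' := by
        apply mul_left_cancel₀ hd'
        linear_combination h3' - h4'
      rw [this]
    omega

lemma cs_pairs {α β : Type*} [DecidableEq α] [DecidableEq β] (Ω : Finset α) (f : α → β) (V : Finset β)
    (hV : ∀ t ∈ Ω, f t ∈ V) :
    #Ω ^ 2 ≤ #V * #{q ∈ Ω ×ˢ Ω | f q.1 = f q.2} := by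
  have h1 : #Ω = ∑ v ∈ V, #{t ∈ Ω | f t = v} := Finset.card_eq_sum_card_fiberwise hV
  have h2 : #{q ∈ Ω ×ˢ Ω | f q.1 = f q.2} = ∑ v ∈ V, #{t ∈ Ω | f t = v} ^ 2 := by
    rw [Finset.card_eq_sum_card_fiberwise (f := fun q : α × α => f q.1) (t := V)]
    · refine Finset.sum_congr rfl fun v _ => ?_
      rw [sq, ← Finset.card_product]
      congr 1
      ext ⟨x, y⟩
      simp only [Finset.mem_filter, Finset.mem_product]
      constructor
      · rintro ⟨⟨⟨h1, h2⟩, h3⟩, h4⟩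
        exact ⟨⟨h1, h4⟩, h2, by rw [← h3, h4]⟩
      · rintro ⟨⟨h1, h2⟩, h3, h4⟩
        exact ⟨⟨⟨h1, h3⟩, by rw [h2, h4]⟩, h2⟩
    · intro q hq
      have hq' := Finset.mem_coe.mp hq
      rw [Finset.mem_filter, Finset.mem_product] at hq'
      exact hV _ hq'.1.1
  rw [h2]
  conv_lhs => rw [h1]
  exact sq_sum_le_card_mul_sum_sq

open Classical in
theorem count (hp : 2 < p) {a b c d e g : ZMod p}
    (hnd : (a ≠ 0 ∧ (b ^ 2 - 4 * a * c ≠ 0 ∨ 4 * a * e - 2 * b * d ≠ 0)) ∨ (a = 0 ∧ b ≠ 0))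
    (A : Finset (ZMod p)) (hA0 : A.Nonempty)
    (hN : (2 : ℝ) * (#(A + A) * (#A) ^ 2) ≤ 10 ^ 6 * (p : ℝ) ^ 2) :
    ((#A : ℝ) * (#A * (#A - 1))) ^ 2 ≤
      #((A ×ˢ A).image (fun q => quad a b c d e g q.1 q.2)) *
      (4 * (10 ^ 8 * (2 * (#(A + A) * (#A : ℝ) ^ 2) * √(2 * (#(A + A) * (#A : ℝ) ^ 2)) +
        2 * #(A + A) * (2 * (#(A + A) * (#A : ℝ) ^ 2))))) := by
  set S := A + A with hS
  set V := (A ×ˢ A).image (fun q => quad a b c d e g q.1 q.2) with hV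
  set A2 := A.filter (fun z => a ≠ 0 ∨ b * z + d ≠ 0) with hA2
  have hA2A : A2 ⊆ A := Finset.filter_subset _ _
  have hA2c : #A ≤ #A2 + 1 := by
    have h1 := Finset.card_filter_add_card_filter_not (s := A) (fun z => a ≠ 0 ∨ b * z + d ≠ 0)
    have h2 : #(A.filter (fun z => ¬ (a ≠ 0 ∨ b * z + d ≠ 0))) ≤ 1 := by
      rw [Finset.card_le_one]
      intro x hx y hy
      rw [Finset.mem_filter] at hx hy
      have hx' := hx.2
      have hy' := hy.2
      push Not at hx' hy'
      rcases hnd with ⟨h, _⟩ | ⟨_, hb⟩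
      · exact absurd hx'.1 h
      · apply mul_left_cancel₀ hb
        linear_combination hx'.2 - hy'.2
    rw [← hA2] at h1
    omega
  have hAS : #A ≤ #S := by
    obtain ⟨x, hx⟩ := hA0
    refine Finset.card_le_card_of_injOn (fun y => x + y) ?_ ?_
    · intro y hy
      exact Finset.add_mem_add hx hy
    · intro y _ y' _ h
      simpa using h
  set Dom := S ×ˢ A ×ˢ A2 with hDom
  have hDomp : ∀ t ∈ Dom, a ≠ 0 ∨ b * t.2.2 + d ≠ 0 := by
    intro t ht
    rw [hDom, Finset.mem_product, Finset.mem_product] at ht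
    exact (Finset.mem_filter.mp ht.2.2).2
  set X := Dom.image (Phi a b c d e) with hX
  have hXc : #X ≤ #S * (#A) ^ 2 := by
    calc #X ≤ #Dom := Finset.card_image_le
      _ = #S * (#A * #A2) := by rw [hDom, Finset.card_product, Finset.card_product]
      _ ≤ #S * (#A * #A) := by gcongr
      _ = _ := by ring
  have hXc' : (#X : ℝ) ≤ #S * (#A : ℝ) ^ 2 := by exact_mod_cast hXc
  have hk1 : #(X.image Prod.fst) ≤ 2 * #S := by
    have : X.image Prod.fst ⊆ S := by
      intro s hs
      rw [Finset.mem_image] at hs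
      obtain ⟨τ, hτ, rfl⟩ := hs
      rw [hX, Finset.mem_image] at hτ
      obtain ⟨t, ht, rfl⟩ := hτ
      rw [hDom, Finset.mem_product] at ht
      exact ht.1
    have := Finset.card_le_card this
    omega
  have hk2 : ∀ (s : ZMod p) (α β : AlgebraicClosure (ZMod p)),
      #{τ ∈ X | τ.1 = s ∧ algebraMap _ (AlgebraicClosure (ZMod p)) τ.2.2 =
        α + β * algebraMap _ _ τ.2.1} ≤ 2 * #S := by
    intro s α β
    set ι := algebraMap (ZMod p) (AlgebraicClosure (ZMod p)) with hι
    set E := Dom.filter (fun t => t.1 = s ∧ ι (Phi a b c d e t).2.2 =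
      α + β * ι (Phi a b c d e t).2.1) with hE
    have h1 : #{τ ∈ X | τ.1 = s ∧ ι τ.2.2 = α + β * ι τ.2.1} ≤ #E := by
      refine le_trans (Finset.card_le_card ?_) (Finset.card_image_le (s := E) (f := Phi a b c d e))
      intro τ hτ
      rw [Finset.mem_filter, hX, Finset.mem_image] at hτ
      obtain ⟨⟨t, ht, rfl⟩, h1, h2⟩ := hτ
      exact Finset.mem_image_of_mem _ (Finset.mem_filter.mpr ⟨ht, h1, h2⟩)
    have h2 : #E ≤ 2 * #A2 := by
      refine Finset.card_le_mul_card_image_of_maps_to (f := fun t => t.2.2) ?_ 2 ?_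
      · intro t ht
        have ht' := Finset.mem_coe.mp ht
        rw [hE, Finset.mem_filter, hDom, Finset.mem_product, Finset.mem_product] at ht'
        exact ht'.1.2.2
      · intro z hz
        have hz' := (Finset.mem_filter.mp hz).2
        have hinj : Set.InjOn (fun t : ZMod p × ZMod p × ZMod p => ι t.2.1)
            ({t ∈ E | t.2.2 = z} : Finset _) := by
          rintro ⟨s1, y1, z1⟩ ht ⟨s2, y2, z2⟩ ht' h
          rw [Finset.mem_coe, Finset.mem_filter, hE, Finset.mem_filter] at ht ht'
          simp only at ht ht' h
          have hy := ι.injective h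
          rw [ht.2, ht'.2, ht.1.2.1, ht'.1.2.1, hy]
        rw [← Finset.card_image_of_injOn hinj]
        refine quad_card _ (ι a) (-(ι (b * z + d) + 2 * ι a * β))
          (ι (c * z ^ 2 + e * z - (a * s ^ 2 + d * s)) + α + β * ι (b * z)) ?_ ?_
        · by_cases ha : a = 0
          · right
            have : b * z + d ≠ 0 := by simpa [ha] using hz'
            rw [ha, map_zero, mul_zero, zero_mul, add_zero, neg_ne_zero]
            exact (map_ne_zero ι).mpr this
          · left
            simpa using ha
        · intro Y hY
          rw [Finset.mem_image] at hY
          obtain ⟨⟨s1, y1, z1⟩, ht, rfl⟩ := hY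
          rw [Finset.mem_filter, hE, Finset.mem_filter] at ht
          simp only [Phi] at ht
          obtain ⟨⟨_, rfl, h3⟩, rfl⟩ := ht
          simp only [map_add, map_sub, map_mul, map_pow, map_ofNat] at h3 ⊢
          linear_combination -h3
    have h3 := Finset.card_le_card hA2A
    omega
  have hXn : (2 * #X : ℝ) ≤ 10 ^ 6 * (p : ℝ) ^ 2 := by linarith
  have hinc := inc_Fp X (2 * #S) hk1 hk2 hXn
  set Ω := A ×ˢ A ×ˢ A2 with hΩ
  have hcs := cs_pairs Ω (fun t => quad a b c d e g t.1 t.2.2) V (by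
    intro t ht
    rw [hΩ, Finset.mem_product, Finset.mem_product] at ht
    rw [hV, Finset.mem_image]
    exact ⟨(t.1, t.2.2), Finset.mem_product.mpr ⟨ht.1, hA2A ht.2.2⟩, rfl⟩)
  set P := {q ∈ Ω ×ˢ Ω | quad a b c d e g q.1.1 q.1.2.2 = quad a b c d e g q.2.1 q.2.2.2} with hP
  set I := {q ∈ X ×ˢ X | q.1.2.2 - q.2.2.2 = q.1.2.1 * q.2.1 - q.2.2.1 * q.1.1} with hI
  have hPI : #P ≤ 4 * #I := by
    let t1 : (ZMod p × ZMod p × ZMod p) × (ZMod p × ZMod p × ZMod p) → ZMod p × ZMod p × ZMod p :=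
      fun q => (q.1.1 + q.1.2.1, q.2.2.1, q.2.2.2)
    let t2 : (ZMod p × ZMod p × ZMod p) × (ZMod p × ZMod p × ZMod p) → ZMod p × ZMod p × ZMod p :=
      fun q => (q.2.1 + q.2.2.1, q.1.2.1, q.1.2.2)
    have ht12 : ∀ q ∈ P, t1 q ∈ Dom ∧ t2 q ∈ Dom := by
      intro q hq
      rw [hP, Finset.mem_filter, Finset.mem_product, hΩ, Finset.mem_product, Finset.mem_product,
        Finset.mem_product, Finset.mem_product] at hq
      obtain ⟨⟨⟨m1, m2, m3⟩, m4, m5, m6⟩, _⟩ := hq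
      simp only [hDom, Finset.mem_product, t1, t2]
      exact ⟨⟨Finset.add_mem_add m1 m2, m5, m6⟩, Finset.add_mem_add m4 m5, m2, m3⟩
    refine Finset.card_le_mul_card_image_of_maps_to
      (f := fun q => (Phi a b c d e (t1 q), Phi a b c d e (t2 q))) ?_ 4 ?_
    · intro q hq
      have hq' := Finset.mem_coe.mp hq
      have h12 := ht12 q hq'
      rw [hP, Finset.mem_filter] at hq'
      rw [hI, Finset.mem_filter, Finset.mem_product]
      refine ⟨⟨Finset.mem_image_of_mem _ h12.1, Finset.mem_image_of_mem _ h12.2⟩, ?_⟩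
      have h3 := hq'.2
      simp only [quad, Phi, t1, t2] at h3 ⊢
      linear_combination h3
    · rintro ⟨τ1, τ2⟩ _
      have f1 := fiber_Phi hp hnd Dom hDomp τ1
      have f2 := fiber_Phi hp hnd Dom hDomp τ2
      calc _ ≤ #(({t ∈ Dom | Phi a b c d e t = τ1} : Finset _) ×ˢ
            ({t ∈ Dom | Phi a b c d e t = τ2} : Finset _)) := by
            refine Finset.card_le_card_of_injOn (fun q => (t1 q, t2 q)) ?_ ?_
            · intro q hq
              have hq' := Finset.mem_coe.mp hq
              rw [Finset.mem_filter] at hq'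
              have h12 := ht12 q hq'.1
              have h3 := hq'.2
              simp only [Prod.mk.injEq] at h3
              rw [Finset.mem_coe, Finset.mem_product, Finset.mem_filter, Finset.mem_filter]
              exact ⟨⟨h12.1, h3.1⟩, h12.2, h3.2⟩
            · rintro ⟨⟨x, y, z⟩, x', y', z'⟩ _ ⟨⟨x1, y1, z1⟩, x1', y1', z1'⟩ _ h
              simp only [t1, t2, Prod.mk.injEq] at h
              obtain ⟨⟨h1, rfl, rfl⟩, h4, rfl, rfl⟩ := h
              simp only [add_left_inj] at h1 h4
              rw [h1, h4]
        _ ≤ 4 := by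
            rw [Finset.card_product]
            nlinarith
  have hΩc : (#A : ℝ) * (#A * (#A - 1)) ≤ #Ω := by
    rw [hΩ, Finset.card_product, Finset.card_product]
    push_cast
    have : (#A : ℝ) ≤ #A2 + 1 := by exact_mod_cast hA2c
    gcongr
    linarith
  have hcs' : (#Ω : ℝ) ^ 2 ≤ #V * #P := by exact_mod_cast hcs
  have hPI' : (#P : ℝ) ≤ 4 * #I := by exact_mod_cast hPI
  have hA1 : (1 : ℝ) ≤ #A := by exact_mod_cast hA0.card_pos
  calc ((#A : ℝ) * (#A * (#A - 1))) ^ 2 ≤ (#Ω : ℝ) ^ 2 := by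
        gcongr
    _ ≤ (#V : ℝ) * (#P : ℝ) := hcs'
    _ ≤ (#V : ℝ) * (4 * (#I : ℝ)) := by gcongr
    _ ≤ _ := by
      gcongr
      refine hinc.trans ?_
      push_cast
      gcongr

end core
end Rud


namespace Rud

section final

lemma numeric (n s v : ℝ) (hn : 2 ≤ n) (hs0 : 0 ≤ s) (hsn : s ≤ n ^ 2) (hv : 0 ≤ v)
    (h : (n * (n * (n - 1))) ^ 2 ≤ v * (4 * (10 ^ 8 * (2 * (s * n ^ 2) * √(2 * (s * n ^ 2)) +
        2 * s * (2 * (s * n ^ 2)))))) : n ^ 6 ≤ 10 ^ 21 * max s v ^ 5 := by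
  set r := √(2 * (s * n ^ 2)) with hr
  have hr0 : 0 ≤ r := Real.sqrt_nonneg _
  have hr2 : r ^ 2 = 2 * (s * n ^ 2) := Real.sq_sqrt (by positivity)
  have hsr : s ≤ r := by
    apply le_of_sq_le_sq _ hr0
    rw [hr2]
    nlinarith [mul_le_mul_of_nonneg_left hsn hs0, mul_nonneg hs0 (sq_nonneg n)]
  rw [← hr2] at h
  have h1 : n ^ 6 / 4 ≤ (n * (n * (n - 1))) ^ 2 := by
    have : n * (n * (n / 2)) ≤ n * (n * (n - 1)) := by
      gcongr; linarith
    calc n ^ 6 / 4 = (n * (n * (n / 2))) ^ 2 := by ring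
      _ ≤ _ := by gcongr
  have h2 : v * (4 * (10 ^ 8 * (r ^ 2 * r + 2 * s * r ^ 2))) ≤
      v * (4 * (10 ^ 8 * (r ^ 2 * r + 2 * r * r ^ 2))) := by gcongr
  have h3 : n ^ 6 ≤ 48 * 10 ^ 8 * (v * r ^ 3) := by nlinarith
  have h4 : (n ^ 6) ^ 2 ≤ (48 * 10 ^ 8 * (v * r ^ 3)) ^ 2 := by gcongr
  have h5 : (48 * 10 ^ 8 * (v * r ^ 3)) ^ 2 = 8 * (48 * 10 ^ 8) ^ 2 * (v ^ 2 * s ^ 3) * n ^ 6 := by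
    have : (r ^ 3) ^ 2 = (2 * (s * n ^ 2)) ^ 3 := by rw [← hr2]; ring
    rw [mul_pow, mul_pow v, this]; ring
  have hn6 : 0 < n ^ 6 := by positivity
  have h6 : n ^ 6 ≤ 8 * (48 * 10 ^ 8) ^ 2 * (v ^ 2 * s ^ 3) := by
    rw [h5, sq] at h4
    exact le_of_mul_le_mul_right h4 hn6
  have hM : v ^ 2 * s ^ 3 ≤ max s v ^ 5 := by
    calc v ^ 2 * s ^ 3 ≤ max s v ^ 2 * max s v ^ 3 := by
          gcongr
          · exact le_max_right _ _
          · exact le_max_left _ _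
      _ = _ := by ring
  have hM0 : 0 ≤ max s v ^ 5 := by
    have : 0 ≤ max s v := le_max_of_le_left hs0
    positivity
  calc n ^ 6 ≤ 8 * (48 * 10 ^ 8) ^ 2 * (v ^ 2 * s ^ 3) := h6
    _ ≤ 8 * (48 * 10 ^ 8) ^ 2 * max s v ^ 5 := by gcongr
    _ ≤ 10 ^ 21 * max s v ^ 5 := by
      gcongr; norm_num

lemma core {p : ℕ} [Fact p.Prime] (hp : 2 < p) {a b c d e g : ZMod p}
    (hnd : (a ≠ 0 ∧ (b ^ 2 - 4 * a * c ≠ 0 ∨ 4 * a * e - 2 * b * d ≠ 0)) ∨ (a = 0 ∧ b ≠ 0))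
    (A : Finset (ZMod p)) (hAp : (#A : ℝ) ≤ (p : ℝ) ^ ((5 : ℝ) / 8)) :
    (1 / 10 ^ 5 : ℝ) * (#A : ℝ) ^ ((6 : ℝ) / 5) ≤ max (#(A + A) : ℝ)
      #((A ×ˢ A).image (fun q => quad a b c d e g q.1 q.2)) := by
  rcases A.eq_empty_or_nonempty with rfl | hA
  · rw [Finset.card_empty, Nat.cast_zero, Real.zero_rpow (by norm_num)]
    simp
  have hAA : (1 : ℝ) ≤ #(A + A) := by exact_mod_cast (hA.add hA).card_pos
  have hA1 : (1 : ℝ) ≤ #A := by exact_mod_cast hA.card_pos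
  rcases Nat.lt_or_ge (#A) 2 with h1 | h2
  · have : #A = 1 := by have := hA.card_pos; omega
    rw [this, Nat.cast_one, Real.one_rpow]
    refine le_max_of_le_left (le_trans ?_ hAA)
    norm_num
  set t : ℝ := (#A : ℝ) ^ ((6 : ℝ) / 5) with ht
  have ht0 : 0 < t := by positivity
  have ht5 : t ^ 5 = (#A : ℝ) ^ 6 := by
    rw [ht, ← Real.rpow_natCast, ← Real.rpow_mul (by positivity), ← Real.rpow_natCast]
    norm_num
  by_contra hcon
  push Not at hcon
  have hS : (#(A + A) : ℝ) < 1 / 10 ^ 5 * t := lt_of_le_of_lt (le_max_left _ _) hcon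
  have hsn : (#(A + A) : ℝ) ≤ (#A : ℝ) ^ 2 := by
    rw [sq]
    exact_mod_cast Finset.card_add_le
  have htp : t * (#A : ℝ) ^ 2 ≤ (p : ℝ) ^ 2 := by
    have e1 : t * (#A : ℝ) ^ 2 = (#A : ℝ) ^ ((16 : ℝ) / 5) := by
      rw [ht, ← Real.rpow_natCast, ← Real.rpow_add (by positivity)]
      norm_num
    have e2 : (p : ℝ) ^ 2 = ((p : ℝ) ^ ((5 : ℝ) / 8)) ^ ((16 : ℝ) / 5) := by
      rw [← Real.rpow_mul (by positivity), ← Real.rpow_natCast]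
      norm_num
    rw [e1, e2]
    exact Real.rpow_le_rpow (by positivity) hAp (by norm_num)
  have hN : (2 : ℝ) * (#(A + A) * (#A) ^ 2) ≤ 10 ^ 6 * (p : ℝ) ^ 2 := by
    have : (#(A + A) : ℝ) * (#A : ℝ) ^ 2 ≤ t * (#A : ℝ) ^ 2 := by
      gcongr
      linarith
    have := sq_nonneg (p : ℝ)
    linarith
  have hc := count (g := g) hp hnd A hA hN
  have hm := numeric _ _ _ (by exact_mod_cast h2) (by positivity) hsn (by positivity) hc
  have h5 : max (#(A + A) : ℝ)
      (#((A ×ˢ A).image (fun q => quad a b c d e g q.1 q.2)) : ℝ) ^ 5 < (1 / 10 ^ 5 * t) ^ 5 :=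
    pow_lt_pow_left₀ hcon (le_max_of_le_left (by positivity)) (by norm_num)
  rw [mul_pow, ht5] at h5
  have : 0 < (#A : ℝ) ^ 6 := by positivity
  norm_num at h5 hm
  linarith

lemma expand {p : ℕ} [Fact p.Prime] (f : MvPolynomial (Fin 2) (ZMod p)) (hf : f.totalDegree ≤ 2) :
    ∃ a b c d e g : ZMod p, f = MvPolynomial.C a * MvPolynomial.X 0 ^ 2 +
      MvPolynomial.C b * MvPolynomial.X 0 * MvPolynomial.X 1 +
      MvPolynomial.C c * MvPolynomial.X 1 ^ 2 + MvPolynomial.C d * MvPolynomial.X 0 +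
      MvPolynomial.C e * MvPolynomial.X 1 + MvPolynomial.C g := by
  have hk : ∀ m : Fin 2 →₀ ℕ, m = Finsupp.single 0 (m 0) + Finsupp.single 1 (m 1) := by
    intro m
    ext i
    fin_cases i <;> simp
  let c : ℕ → ℕ → ZMod p := fun i j => f.coeff (Finsupp.single 0 i + Finsupp.single 1 j)
  let T : Finset (ℕ × ℕ) := {(2, 0), (1, 1), (0, 2), (1, 0), (0, 1), (0, 0)}
  have key : f = ∑ ij ∈ T, MvPolynomial.C (c ij.1 ij.2) * MvPolynomial.X 0 ^ ij.1 *
      MvPolynomial.X 1 ^ ij.2 := by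
    have hmon : ∀ i j : ℕ, ∀ r : ZMod p, MvPolynomial.C r * MvPolynomial.X 0 ^ i *
      MvPolynomial.X 1 ^ j = MvPolynomial.monomial
        ((Finsupp.single 0 i + Finsupp.single 1 j : Fin 2 →₀ ℕ)) r := by
      intro i j r
      rw [MvPolynomial.X_pow_eq_monomial, MvPolynomial.X_pow_eq_monomial,
        MvPolynomial.C_mul_monomial, MvPolynomial.monomial_mul]
      simp
    ext m
    rw [MvPolynomial.coeff_sum]
    simp only [hmon, MvPolynomial.coeff_monomial]
    have hiff : ∀ ij : ℕ × ℕ, (Finsupp.single 0 ij.1 + Finsupp.single 1 ij.2 = m) ↔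
        ij = (m 0, m 1) := by
      rintro ⟨i, j⟩
      constructor
      · intro h; rw [← h]; simp
      · intro h
        simp only [Prod.mk.injEq] at h
        rw [h.1, h.2, ← hk m]
    simp only [hiff]
    rw [Finset.sum_ite_eq']
    split_ifs with hT
    · show _ = f.coeff _
      rw [← hk m]
    · by_contra hne
      apply hT
      have h1 := MvPolynomial.le_totalDegree (MvPolynomial.mem_support_iff.mpr hne)
      have h2 : m.sum (fun _ e => e) = m 0 + m 1 := by
        rw [Finsupp.sum_fintype _ _ (by simp), Fin.sum_univ_two]
      rw [h2] at h1
      have h3 : m 0 + m 1 ≤ 2 := h1.trans hf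
      generalize m 0 = i at *
      generalize m 1 = j at *
      have hi : i ≤ 2 := by omega
      have hj : j ≤ 2 := by omega
      interval_cases i <;> interval_cases j <;> first | omega | decide
  refine ⟨c 2 0, c 1 1, c 0 2, c 1 0, c 0 1, c 0 0, ?_⟩
  conv_lhs => rw [key]
  simp only [T]
  rw [Finset.sum_insert (by decide), Finset.sum_insert (by decide), Finset.sum_insert (by decide),
    Finset.sum_insert (by decide), Finset.sum_insert (by decide), Finset.sum_singleton]
  simp only [pow_zero, pow_one, mul_one]
  ring

end final
end Rud

theorem stmt_5 :
    ∃ c : ℝ, 0 < c ∧ ∀ (p : ℕ), p.Prime → 2 < p →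
      ∀ (f : MvPolynomial (Fin 2) (ZMod p)), f.totalDegree = 2 →
        (0 : Fin 2) ∈ f.vars → (1 : Fin 2) ∈ f.vars →
        (¬ ∃ (g : Polynomial (ZMod p)) (α β : ZMod p),
          f = Polynomial.aeval (MvPolynomial.C α * MvPolynomial.X 0 +
                MvPolynomial.C β * MvPolynomial.X 1) g) →
      ∀ A : Finset (ZMod p), (A.card : ℝ) ≤ (p : ℝ) ^ ((5 : ℝ) / 8) →
      c * (A.card : ℝ) ^ ((6 : ℝ) / 5) ≤
        max ((A + A).card : ℝ)
          (((((A ×ˢ A)).image (fun q => MvPolynomial.eval ![q.1, q.2] f)).card : ℝ)) := by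
  refine ⟨1 / 10 ^ 5, by norm_num, ?_⟩
  intro p hpp hp f hdeg _ _ hng A hAp
  have : Fact p.Prime := ⟨hpp⟩
  obtain ⟨a, b, c, d, e, g, hf⟩ := Rud.expand f hdeg.le
  have h2 : (2 : ZMod p) ≠ 0 := Rud.two_ne hp
  have hev : ∀ x y : ZMod p, MvPolynomial.eval ![x, y] f = Rud.quad a b c d e g x y := by
    intro x y
    rw [hf]
    simp [Rud.quad]
  simp only [hev]
  by_cases ha : a = 0
  · by_cases hb : b = 0
    · have hc : c * d ≠ 0 := by
        intro hcd
        apply hng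
        rcases mul_eq_zero.mp hcd with hc | hd
        · refine ⟨Polynomial.X + Polynomial.C g, d, e, ?_⟩
          rw [hf, ha, hb, hc]
          simp [MvPolynomial.algebraMap_eq]
        · refine ⟨Polynomial.C c * Polynomial.X ^ 2 + Polynomial.C e * Polynomial.X +
            Polynomial.C g, 0, 1, ?_⟩
          rw [hf, ha, hb, hd]
          simp [MvPolynomial.algebraMap_eq]
      have h := Rud.core (a := c) (b := 0) (c := 0) (d := e) (e := d) (g := g) hp (by
        left
        refine ⟨left_ne_zero_of_mul hc, Or.inr ?_⟩
        have : 4 * c * d - 2 * 0 * e = 2 * 2 * (c * d) := by ring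
        rw [this]
        exact mul_ne_zero (mul_ne_zero h2 h2) hc) A hAp
      convert h using 4
      ext w
      simp only [Finset.mem_image, Finset.mem_product, Prod.exists]
      constructor
      · rintro ⟨x, y, ⟨hx, hy⟩, rfl⟩
        refine ⟨y, x, ⟨hy, hx⟩, ?_⟩
        rw [ha, hb]; simp only [Rud.quad]; ring
      · rintro ⟨x, y, ⟨hx, hy⟩, rfl⟩
        refine ⟨y, x, ⟨hy, hx⟩, ?_⟩
        rw [ha, hb]; simp only [Rud.quad]; ring
    · exact Rud.core hp (Or.inr ⟨ha, hb⟩) A hAp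
  · refine Rud.core hp (Or.inl ⟨ha, ?_⟩) A hAp
    by_contra hcon
    push Not at hcon
    obtain ⟨hD, hE⟩ := hcon
    apply hng
    refine ⟨Polynomial.C (4 * a)⁻¹ * Polynomial.X ^ 2 +
      Polynomial.C (d * (2 * a)⁻¹) * Polynomial.X + Polynomial.C g, 2 * a, b, ?_⟩
    have h4 : (4 : ZMod p) ≠ 0 := by
      have : (4 : ZMod p) = 2 * 2 := by norm_num
      rw [this]; exact mul_ne_zero h2 h2
    have e1 : a = (4 * a)⁻¹ * (2 * a) ^ 2 := by field_simp; norm_num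
    have e2 : b = (4 * a)⁻¹ * (2 * (2 * a) * b) := by field_simp; norm_num
    have e3 : c = (4 * a)⁻¹ * b ^ 2 := by field_simp; linear_combination -hD
    have e4 : d = d * (2 * a)⁻¹ * (2 * a) := by field_simp
    have e5 : e = d * (2 * a)⁻¹ * b := by
      field_simp
      apply mul_left_cancel₀ h2
      linear_combination hE
    conv_lhs => rw [hf, e1, e2, e3, e4, e5]
    simp only [map_add, map_mul, map_pow, Polynomial.aeval_C, Polynomial.aeval_X,
      map_ofNat, MvPolynomial.algebraMap_eq]
    ring
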